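/- arXiv:1808.03369 — 3 statements merged into one kernel-verified Lean document; each statement's English description precedes it below -/
import Mathlib

section
/- Let k ≥ 2 be an integer and λ₀, …, λ_{k−1} positive real numbers with |λ| := λ₀ + ⋯ + λ_{k−1}. Let x₀, …, x_{k−1} be real numbers and r ≥ 0 be such that 2r x_i < 1 + r² for each i. Then ∏_{i=0}^{k−1} (1 − 2r x_i + r²)^{−λ_i} = (Γ(|λ|)/∏_{i=0}^{k−1} Γ(λ_i)) ∫_{T^{k−1}} (1 − 2r Σ_{i=0}^{k−1} x_i u_i + r²)^{−|λ|} ∏_{i=0}^{k−1} u_i^{λ_i−1} du, where u₀ := 1 − u_1 − ⋯ − u_{k−1}. -/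
open Real MeasureTheory Finset

noncomputable section

/-- The simplex `T^{m} = {u : u_i ≥ 0, Σ u_i ≤ 1}` in `ℝ^m`. -/
def simplexT (m : ℕ) : Set (Fin m → ℝ) := {u | (∀ i, 0 ≤ u i) ∧ ∑ i, u i ≤ 1}

/-- `u₀ = 1 - u_1 - ⋯ - u_m`. -/
def u0 {m : ℕ} (u : Fin m → ℝ) : ℝ := 1 - ∑ i, u i

/-- The full barycentric vector `(u₀, u_1, …, u_m)`. -/
def uFull {m : ℕ} (u : Fin m → ℝ) : Fin (m + 1) → ℝ := Fin.cons (u0 u) u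

theorem sum_uFull {m : ℕ} (u : Fin m → ℝ) : ∑ j, uFull u j = 1 := by
  simp [uFull, u0, Fin.sum_univ_succ]

theorem measurable_uFull {m : ℕ} : Measurable (uFull : (Fin m → ℝ) → Fin (m + 1) → ℝ) := by
  refine measurable_pi_iff.2 fun j => ?_
  refine Fin.cases ?_ (fun i => ?_) j
  · simp only [uFull, u0, Fin.cons_zero]; fun_prop
  · simp only [uFull, Fin.cons_succ]; fun_prop

theorem mem_simplexT_iff_uFull_nonneg {m : ℕ} (u : Fin m → ℝ) :
    u ∈ simplexT m ↔ ∀ j, 0 ≤ uFull u j := by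
  simp [simplexT, uFull, u0, Fin.forall_fin_succ, and_comm]

theorem measurableSet_simplexT (m : ℕ) : MeasurableSet (simplexT m) := by
  have : simplexT m = ⋂ j, {u | 0 ≤ uFull u j} := by
    ext u; simp [mem_simplexT_iff_uFull_nonneg]
  rw [this]
  exact MeasurableSet.iInter fun j =>
    measurableSet_le measurable_const ((measurable_pi_apply j).comp measurable_uFull)

theorem lintegral_eq_pow_mul_lintegral_smul {m : ℕ} {s : ℝ} (hs : 0 < s)
    {f : (Fin m → ℝ) → ENNReal} (hf : Measurable f) :
    ∫⁻ v, f v = ENNReal.ofReal (s ^ m) * ∫⁻ u, f (s • u) := by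
  rw [← lintegral_map (g := fun u : Fin m → ℝ => s • u) hf (by fun_prop),
    Measure.map_addHaar_smul volume hs.ne', lintegral_smul_measure, smul_eq_mul, ← mul_assoc,
    ← ENNReal.ofReal_mul (by positivity), abs_of_nonneg (by positivity)]
  simp [mul_inv_cancel₀ (pow_pos hs m).ne']

theorem lintegral_fin_succ {m : ℕ} {G : (Fin (m + 1) → ℝ) → ENNReal} (hG : Measurable G) :
    ∫⁻ t, G t = ∫⁻ v : Fin m → ℝ, ∫⁻ t₀ : ℝ, G (Fin.cons t₀ v) := by
  have h := (volume_preserving_piFinSuccAbove (fun _ : Fin (m + 1) => ℝ) 0).symm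
  rw [← h.lintegral_comp hG, Measure.volume_eq_prod,
    lintegral_prod_symm' (fun p : ℝ × (Fin m → ℝ) =>
      G ((MeasurableEquiv.piFinSuccAbove (fun _ : Fin (m + 1) => ℝ) 0).symm p))
      (hG.comp (MeasurableEquiv.measurable _))]
  simp [MeasurableEquiv.piFinSuccAbove_symm_apply, Fin.insertNthEquiv]

theorem smul_uFull {m : ℕ} (s : ℝ) (u : Fin m → ℝ) :
    s • uFull u = Fin.cons (s - ∑ i, (s • u) i) (s • u) := by
  ext j
  refine Fin.cases ?_ (fun i => ?_) j
  · simp [uFull, u0, mul_sub, Finset.mul_sum]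
  · simp [uFull]

/-- Integration over the nonnegative orthant in the coordinates `t = s • uFull u`. -/
theorem lintegral_orthant_eq_lintegral_smul_uFull {m : ℕ} {G : (Fin (m + 1) → ℝ) → ENNReal}
    (hG : Measurable G) (hsupp : ∀ t, G t ≠ 0 → ∀ j, 0 ≤ t j) :
    ∫⁻ t, G t =
      ∫⁻ u : Fin m → ℝ, ∫⁻ s in Set.Ioi (0 : ℝ), ENNReal.ofReal (s ^ m) * G (s • uFull u) := by
  have hcons : Measurable fun p : (Fin m → ℝ) × ℝ =>
      (Fin.cons (p.2 - ∑ i, p.1 i) p.1 : Fin (m + 1) → ℝ) := by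
    refine measurable_pi_iff.2 fun j => ?_
    refine Fin.cases ?_ (fun i => ?_) j
    · simp only [Fin.cons_zero]; fun_prop
    · simp only [Fin.cons_succ]; fun_prop
  have hzero : ∀ (v : Fin m → ℝ) (s : ℝ), s < 0 → G (Fin.cons (s - ∑ i, v i) v) = 0 := by
    intro v s hs
    by_contra h
    have h0 := hsupp _ h
    have : 0 ≤ ∑ j, (Fin.cons (s - ∑ i, v i) v : Fin (m + 1) → ℝ) j :=
      Finset.sum_nonneg fun j _ => h0 j
    simp [Fin.sum_univ_succ] at this
    linarith
  have hmeas : Measurable fun p : (Fin m → ℝ) × ℝ =>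
      ENNReal.ofReal (p.2 ^ m) * G (p.2 • uFull p.1) := by
    have h1 : Measurable fun p : (Fin m → ℝ) × ℝ => p.2 • uFull p.1 :=
      measurable_snd.smul (measurable_uFull.comp measurable_fst)
    exact (by fun_prop : Measurable fun p : (Fin m → ℝ) × ℝ => ENNReal.ofReal (p.2 ^ m)).mul
      (hG.comp h1)
  calc ∫⁻ t, G t
      = ∫⁻ v : Fin m → ℝ, ∫⁻ s : ℝ, G (Fin.cons (s - ∑ i, v i) v) := by
        rw [lintegral_fin_succ hG]
        refine lintegral_congr fun v => ?_
        exact (lintegral_sub_right_eq_self (fun t₀ : ℝ => G (Fin.cons t₀ v)) _).symm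
    _ = ∫⁻ v : Fin m → ℝ, ∫⁻ s in Set.Ioi (0 : ℝ), G (Fin.cons (s - ∑ i, v i) v) := by
        refine lintegral_congr fun v => ?_
        rw [← setLIntegral_congr (Ioi_ae_eq_Ici (a := (0 : ℝ))).symm,
          setLIntegral_eq_of_support_subset]
        intro s hs
        by_contra h
        exact hs (hzero v s (not_le.1 h))
    _ = ∫⁻ s in Set.Ioi (0 : ℝ), ∫⁻ v : Fin m → ℝ, G (Fin.cons (s - ∑ i, v i) v) :=
        lintegral_lintegral_swap (hG.comp hcons).aemeasurable
    _ = ∫⁻ s in Set.Ioi (0 : ℝ), ∫⁻ u : Fin m → ℝ,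
          ENNReal.ofReal (s ^ m) * G (s • uFull u) := by
        refine setLIntegral_congr_fun measurableSet_Ioi fun s hs => ?_
        have hs' : Measurable fun v : Fin m → ℝ =>
            G (Fin.cons (s - ∑ i, v i) v : Fin (m + 1) → ℝ) :=
          (hG.comp hcons).comp (measurable_id.prodMk measurable_const)
        rw [lintegral_eq_pow_mul_lintegral_smul hs hs',
          lintegral_const_mul' _ _ ENNReal.ofReal_ne_top]
        simp_rw [smul_uFull]
    _ = _ := (lintegral_lintegral_swap hmeas.aemeasurable).symm

/-- The unnormalised density of the Gamma distribution of shape `l` and rate `a`. -/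
def gammaKernel (l a : ℝ) : ℝ → ℝ :=
  (Set.Ici 0).indicator fun t => t ^ (l - 1) * Real.exp (-(a * t))

theorem measurable_gammaKernel (l a : ℝ) : Measurable (gammaKernel l a) :=
  (by fun_prop : Measurable fun t : ℝ => t ^ (l - 1) * Real.exp (-(a * t))).indicator
    measurableSet_Ici

theorem gammaKernel_nonneg (l a t : ℝ) : 0 ≤ gammaKernel l a t :=
  Set.indicator_nonneg (fun t ht => by have : (0 : ℝ) ≤ t := ht; positivity) t

theorem integrableOn_rpow_mul_exp_neg_mul {l a : ℝ} (hl : 0 < l) (ha : 0 < a) :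
    IntegrableOn (fun t : ℝ => t ^ (l - 1) * Real.exp (-(a * t))) (Set.Ioi 0) := by
  simpa using integrableOn_rpow_mul_exp_neg_mul_rpow (s := l - 1) (by linarith) one_pos ha

theorem integrable_gammaKernel {l a : ℝ} (hl : 0 < l) (ha : 0 < a) :
    Integrable (gammaKernel l a) := by
  rw [gammaKernel, integrable_indicator_iff measurableSet_Ici, integrableOn_Ici_iff_integrableOn_Ioi]
  exact integrableOn_rpow_mul_exp_neg_mul hl ha

theorem integral_gammaKernel {l a : ℝ} (hl : 0 < l) (ha : 0 < a) :
    ∫ t, gammaKernel l a t = a ^ (-l) * Real.Gamma l := by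
  rw [gammaKernel, integral_indicator measurableSet_Ici, integral_Ici_eq_integral_Ioi,
    Real.integral_rpow_mul_exp_neg_mul_Ioi hl ha, one_div, Real.inv_rpow ha.le,
    Real.rpow_neg ha.le]

theorem lintegral_prod_gammaKernel {n : ℕ} {l a : Fin n → ℝ} (hl : ∀ i, 0 < l i)
    (ha : ∀ i, 0 < a i) :
    ∫⁻ t : Fin n → ℝ, ENNReal.ofReal (∏ i, gammaKernel (l i) (a i) (t i)) =
      ENNReal.ofReal (∏ i, a i ^ (-l i) * Real.Gamma (l i)) := by
  have h := Integrable.fin_nat_prod (μ := fun _ => volume)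
    fun i => integrable_gammaKernel (hl i) (ha i)
  rw [← volume_pi] at h
  rw [← ofReal_integral_eq_lintegral_ofReal h
    (Filter.Eventually.of_forall fun t => Finset.prod_nonneg fun i _ => gammaKernel_nonneg _ _ _),
    integral_fin_nat_prod_volume_eq_prod]
  simp_rw [integral_gammaKernel (hl _) (ha _)]

theorem sum_mul_uFull_pos {m : ℕ} {a : Fin (m + 1) → ℝ} (ha : ∀ j, 0 < a j) {u : Fin m → ℝ}
    (hu : u ∈ simplexT m) : 0 < ∑ j, a j * uFull u j := by
  rw [mem_simplexT_iff_uFull_nonneg] at hu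
  have hnn : ∀ j ∈ Finset.univ, 0 ≤ a j * uFull u j := fun j _ => mul_nonneg (ha j).le (hu j)
  refine (Finset.sum_nonneg hnn).lt_of_ne' fun h => ?_
  have h0 := (Finset.sum_eq_zero_iff_of_nonneg hnn).1 h
  have : ∑ j, uFull u j = 0 := Finset.sum_eq_zero fun j hj =>
    (mul_eq_zero.1 (h0 j hj)).resolve_left (ha j).ne'
  simp [sum_uFull] at this

theorem pow_mul_prod_gammaKernel_smul {m : ℕ} (l a : Fin (m + 1) → ℝ) {u : Fin m → ℝ}
    (hu : u ∈ simplexT m) {s : ℝ} (hs : 0 < s) :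
    s ^ m * ∏ j, gammaKernel (l j) (a j) ((s • uFull u) j) =
      (∏ j, uFull u j ^ (l j - 1)) *
        (s ^ (∑ j, l j - 1) * Real.exp (-((∑ j, a j * uFull u j) * s))) := by
  rw [mem_simplexT_iff_uFull_nonneg] at hu
  have h1 : ∀ j, gammaKernel (l j) (a j) ((s • uFull u) j) =
      s ^ (l j - 1) * uFull u j ^ (l j - 1) * Real.exp (-(a j * uFull u j * s)) := by
    intro j
    rw [gammaKernel, Set.indicator_of_mem (by simpa using mul_nonneg hs.le (hu j)),
      Pi.smul_apply, smul_eq_mul, Real.mul_rpow hs.le (hu j)]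
    ring_nf
  simp_rw [h1, Finset.prod_mul_distrib]
  rw [← Real.exp_sum, ← Real.rpow_sum_of_pos hs, Finset.sum_neg_distrib, ← Finset.sum_mul,
    Finset.sum_sub_distrib]
  have h2 : s ^ (∑ j, l j - 1) = s ^ m * s ^ (∑ j, l j - ∑ _j : Fin (m + 1), (1 : ℝ)) := by
    rw [← Real.rpow_natCast, ← Real.rpow_add hs]
    congr 1
    simp
    ring
  rw [h2]
  ring

theorem lintegral_pow_mul_prod_gammaKernel_smul {m : ℕ} {l a : Fin (m + 1) → ℝ}
    (hl : ∀ j, 0 < l j) (ha : ∀ j, 0 < a j) (u : Fin m → ℝ) :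
    ∫⁻ s in Set.Ioi (0 : ℝ), ENNReal.ofReal (s ^ m) *
        ENNReal.ofReal (∏ j, gammaKernel (l j) (a j) ((s • uFull u) j)) =
      (simplexT m).indicator (fun u => ENNReal.ofReal (Real.Gamma (∑ j, l j) *
        ((∑ j, a j * uFull u j) ^ (-∑ j, l j) * ∏ j, uFull u j ^ (l j - 1)))) u := by
  by_cases hu : u ∈ simplexT m
  · have hA := sum_mul_uFull_pos ha hu
    have hL : 0 < ∑ j, l j := Finset.sum_pos (fun j _ => hl j) Finset.univ_nonempty
    have hP : 0 ≤ ∏ j, uFull u j ^ (l j - 1) := Finset.prod_nonneg fun j _ =>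
      Real.rpow_nonneg ((mem_simplexT_iff_uFull_nonneg u).1 hu j) _
    rw [Set.indicator_of_mem hu]
    calc _ = ∫⁻ s in Set.Ioi (0 : ℝ), ENNReal.ofReal ((∏ j, uFull u j ^ (l j - 1)) *
        (s ^ (∑ j, l j - 1) * Real.exp (-((∑ j, a j * uFull u j) * s)))) := by
          refine setLIntegral_congr_fun measurableSet_Ioi fun s hs => ?_
          have hs : (0 : ℝ) < s := hs
          rw [← ENNReal.ofReal_mul (by positivity), pow_mul_prod_gammaKernel_smul l a hu hs]
      _ = _ := by
          rw [← ofReal_integral_eq_lintegral_ofReal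
            ((integrableOn_rpow_mul_exp_neg_mul hL hA).const_mul _), integral_const_mul,
            Real.integral_rpow_mul_exp_neg_mul_Ioi hL hA, one_div, Real.inv_rpow hA.le,
            Real.rpow_neg hA.le]
          · ring_nf
          · refine (ae_restrict_iff' measurableSet_Ioi).2 (Filter.Eventually.of_forall fun s hs => ?_)
            have hs : (0 : ℝ) < s := hs
            simp only [Pi.zero_apply]
            positivity
  · rw [Set.indicator_of_notMem hu]
    rw [mem_simplexT_iff_uFull_nonneg] at hu
    push Not at hu
    obtain ⟨j, hj⟩ := hu
    refine setLIntegral_eq_zero measurableSet_Ioi fun s hs => ?_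
    have hs : (0 : ℝ) < s := hs
    have : gammaKernel (l j) (a j) ((s • uFull u) j) = 0 :=
      Set.indicator_of_notMem (by simpa using mul_neg_of_pos_of_neg hs hj) _
    rw [Finset.prod_eq_zero (f := fun j => gammaKernel (l j) (a j) ((s • uFull u) j))
      (Finset.mem_univ j) this, ENNReal.ofReal_zero, mul_zero, Pi.zero_apply]

/-- The Dirichlet form of Feynman's parametrisation: a product of negative powers as an integral
over the simplex. -/
theorem prod_rpow_neg_eq_integral_simplexT {m : ℕ} {l a : Fin (m + 1) → ℝ}
    (hl : ∀ j, 0 < l j) (ha : ∀ j, 0 < a j) :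
    ∏ j, a j ^ (-l j) = (Real.Gamma (∑ j, l j) / ∏ j, Real.Gamma (l j)) *
      ∫ u in simplexT m, (∑ j, a j * uFull u j) ^ (-∑ j, l j) * ∏ j, uFull u j ^ (l j - 1) := by
  have hL : 0 < ∑ j, l j := Finset.sum_pos (fun j _ => hl j) Finset.univ_nonempty
  have hmeas : Measurable fun t : Fin (m + 1) → ℝ =>
      ENNReal.ofReal (∏ j, gammaKernel (l j) (a j) (t j)) :=
    ENNReal.measurable_ofReal.comp <| Finset.measurable_prod _ fun j _ =>
      (measurable_gammaKernel _ _).comp (measurable_pi_apply j)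
  have hsupp : ∀ t : Fin (m + 1) → ℝ,
      ENNReal.ofReal (∏ j, gammaKernel (l j) (a j) (t j)) ≠ 0 → ∀ j, 0 ≤ t j := by
    intro t ht j
    by_contra hj
    refine ht ?_
    rw [Finset.prod_eq_zero (Finset.mem_univ j) (Set.indicator_of_notMem hj _),
      ENNReal.ofReal_zero]
  have key := lintegral_orthant_eq_lintegral_smul_uFull hmeas hsupp
  rw [lintegral_prod_gammaKernel hl ha] at key
  simp_rw [lintegral_pow_mul_prod_gammaKernel_smul hl ha] at key
  rw [lintegral_indicator (measurableSet_simplexT m)] at key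
  have hu : ∀ j, Measurable fun u : Fin m → ℝ => uFull u j := fun j =>
    (measurable_pi_apply j).comp measurable_uFull
  have hnn : 0 ≤ᵐ[volume.restrict (simplexT m)] fun u => Real.Gamma (∑ j, l j) *
      ((∑ j, a j * uFull u j) ^ (-∑ j, l j) * ∏ j, uFull u j ^ (l j - 1)) := by
    refine (ae_restrict_iff' (measurableSet_simplexT m)).2
      (Filter.Eventually.of_forall fun u hu => ?_)
    have := sum_mul_uFull_pos ha hu
    have hP : 0 ≤ ∏ j, uFull u j ^ (l j - 1) := Finset.prod_nonneg fun j _ =>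
      Real.rpow_nonneg ((mem_simplexT_iff_uFull_nonneg u).1 hu j) _
    simp only [Pi.zero_apply]
    positivity
  have hint := integral_eq_lintegral_of_nonneg_ae hnn
    (by fun_prop : Measurable _).aestronglyMeasurable
  have hpos : 0 < ∏ j, Real.Gamma (l j) :=
    Finset.prod_pos fun j _ => Real.Gamma_pos_of_pos (hl j)
  rw [← key, ENNReal.toReal_ofReal (Finset.prod_nonneg fun j _ =>
    mul_nonneg (Real.rpow_nonneg (ha j).le _) (Real.Gamma_pos_of_pos (hl j)).le),
    integral_const_mul, Finset.prod_mul_distrib] at hint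
  rw [div_mul_eq_mul_div, hint, mul_div_cancel_right₀ _ hpos.ne']

/-- the product formula
`∏_{i=0}^{k−1} (1 − 2r x_i + r²)^{−λ_i}
  = (Γ(|λ|)/∏ Γ(λ_i)) ∫_{T^{k−1}} (1 − 2r Σ x_i u_i + r²)^{−|λ|} ∏ u_i^{λ_i−1} du`. -/
theorem product_formula_simplex (k : ℕ) (hk : 2 ≤ k) (lam : Fin k → ℝ)
    (hlam : ∀ i, 0 < lam i) (x : Fin k → ℝ) (r : ℝ) (hr : 0 ≤ r)
    (hx : ∀ i, 2 * r * x i < 1 + r ^ 2) :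
    (∏ i, (1 - 2 * r * x i + r ^ 2) ^ (-(lam i))) =
      (Real.Gamma (∑ i, lam i) / ∏ i, Real.Gamma (lam i)) *
        ∫ u in simplexT (k - 1),
          (1 - 2 * r * (∑ j : Fin (k - 1 + 1),
              x (Fin.cast (by omega) j) * uFull u j) + r ^ 2) ^ (-(∑ i, lam i)) *
            ∏ j : Fin (k - 1 + 1), uFull u j ^ (lam (Fin.cast (by omega) j) - 1) := by
  obtain ⟨m, rfl⟩ : ∃ m, k = m + 1 := ⟨k - 1, by omega⟩
  have h := prod_rpow_neg_eq_integral_simplexT hlam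
    (a := fun i => 1 - 2 * r * x i + r ^ 2) fun i => by linarith [hx i]
  have hbase : ∀ u : Fin m → ℝ, ∑ j, (1 - 2 * r * x j + r ^ 2) * uFull u j =
      1 - 2 * r * (∑ j, x j * uFull u j) + r ^ 2 := by
    intro u
    calc _ = (1 + r ^ 2) * ∑ j, uFull u j - 2 * r * ∑ j, x j * uFull u j := by
          rw [Finset.mul_sum, Finset.mul_sum, ← Finset.sum_sub_distrib]
          exact Finset.sum_congr rfl fun j _ => by ring
      _ = _ := by rw [sum_uFull]; ring
  simp_rw [hbase] at h
  exact h
end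
end

section
/- Let λ > 0, let k ≥ 2 be an integer and let p be an integer with 0 ≤ p ≤ k−1. Let (q_n)_{n≥0} be an orthogonal polynomial sequence for w⁻ with normalized squared norms h_n⁻, and let (s_n)_{n≥0} be an orthogonal polynomial sequence for w⁺ with normalized squared norms h_n⁺. Then for all θ ∈ ℝ and 0 ≤ r < 1 the following series converges absolutely and Σ_{n=0}^∞ (q_n(cos θ) q_n(cos(pπ/k))/h_n⁻) r^n + 2 sin θ sin(pπ/k) Σ_{n=0}^∞ (s_n(cos θ) s_n(cos(pπ/k))/h_n⁺) r^{n+1} = (1 − r²) / ( (1 − 2r cos(θ − pπ/k) + r²) (1 − 2(−1)^p r^k cos(kθ) + r^{2k})^λ ). (This is the closed formula for the Poisson kernel of the h-harmonics of the dihedral group I_k with one parameter λ, when one argument is a vertex (cos(pπ/k), sin(pπ/k)) of the regular k-gon.) -/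
open Real MeasureTheory Polynomial Finset

noncomputable section

def chebT (n : ℤ) (t : ℝ) : ℝ := (Polynomial.Chebyshev.T ℝ n).eval t
def chebU (n : ℤ) (t : ℝ) : ℝ := (Polynomial.Chebyshev.U ℝ n).eval t

/-- `w⁻(t) = |U_{k−1}(t)|^{2λ}(1−t²)^{λ−1/2}`. -/
def wminus (lam : ℝ) (k : ℕ) (t : ℝ) : ℝ :=
  |chebU ((k : ℤ) - 1) t| ^ (2 * lam) * (1 - t ^ 2) ^ (lam - 1 / 2)

/-- `w⁺(t) = |U_{k−1}(t)|^{2λ}(1−t²)^{λ+1/2}`. -/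
def wplus (lam : ℝ) (k : ℕ) (t : ℝ) : ℝ :=
  |chebU ((k : ℤ) - 1) t| ^ (2 * lam) * (1 - t ^ 2) ^ (lam + 1 / 2)

/-- `(p_n)` is an orthogonal polynomial sequence for the weight `w` on `(−1,1)`. -/
def IsOPS (w : ℝ → ℝ) (p : ℕ → Polynomial ℝ) : Prop :=
  (∀ n : ℕ, (p n).degree = n) ∧
  ∀ n m : ℕ, n ≠ m → (∫ t in (-1 : ℝ)..1, (p n).eval t * (p m).eval t * w t) = 0

/-- normalized squared norm `h_n = (∫ p² w)/(∫ w)`. -/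
def hnorm (w : ℝ → ℝ) (p : Polynomial ℝ) : ℝ :=
  (∫ t in (-1 : ℝ)..1, (p.eval t) ^ 2 * w t) / (∫ t in (-1 : ℝ)..1, w t)

/-- The rising binomial coefficient `(μ)ₙ / n!`. -/
def risingBinom (mu : ℝ) (n : ℕ) : ℝ := (ascPochhammer ℝ n).eval mu / n.factorial

lemma risingBinom_zero (mu : ℝ) : risingBinom mu 0 = 1 := by simp [risingBinom]

lemma risingBinom_succ (mu : ℝ) (n : ℕ) :
    (n + 1) * risingBinom mu (n + 1) = (mu + n) * risingBinom mu n := by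
  have : (n.factorial : ℝ) ≠ 0 := by positivity
  simp only [risingBinom, ascPochhammer_succ_eval, Nat.factorial_succ]
  push_cast
  field_simp

lemma risingBinom_pos {mu : ℝ} (h : 0 < mu) (n : ℕ) : 0 < risingBinom mu n :=
  div_pos (ascPochhammer_pos n mu h) (by positivity)

lemma risingBinom_eq_choose (mu : ℝ) (n : ℕ) :
    risingBinom mu n = Ring.choose (mu + n - 1) n := by
  have h : (n.factorial : ℝ) ≠ 0 := by positivity
  have := Ring.factorial_nsmul_multichoose_eq_ascPochhammer mu n
  rw [ascPochhammer_smeval_eq_eval] at this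
  rw [risingBinom, Ring.choose, ← this, nsmul_eq_mul, mul_div_cancel_left₀ _ h]
  congr 1
  ring

lemma risingBinom_add_one (mu : ℝ) (n : ℕ) :
    mu * risingBinom (mu + 1) n = (mu + n) * risingBinom mu n := by
  induction n with
  | zero => simp [risingBinom_zero]
  | succ n ih =>
    have h : (n + 1 : ℝ) ≠ 0 := by positivity
    apply mul_left_cancel₀ h
    have h1 := risingBinom_succ mu n
    have h2 := risingBinom_succ (mu + 1) n
    push_cast
    linear_combination mu * h2 + (mu + 1 + n) * ih - (mu + (n + 1)) * h1

lemma sum_risingBinom_mul_succ (mu nu : ℝ) (n : ℕ) :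
    (n + 1) * ∑ x ∈ antidiagonal (n + 1), risingBinom mu x.1 * risingBinom nu x.2 =
      (mu + nu + n) * ∑ x ∈ antidiagonal n, risingBinom mu x.1 * risingBinom nu x.2 := by
  have h1 : ∑ x ∈ antidiagonal (n + 1), x.1 * (risingBinom mu x.1 * risingBinom nu x.2) =
      ∑ x ∈ antidiagonal n, (mu + x.1) * (risingBinom mu x.1 * risingBinom nu x.2) := by
    rw [Finset.Nat.sum_antidiagonal_succ]
    simp only [Nat.cast_zero, zero_mul, zero_add]
    refine Finset.sum_congr rfl fun x _ => ?_
    have := risingBinom_succ mu x.1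
    push_cast
    linear_combination risingBinom nu x.2 * this
  have h2 : ∑ x ∈ antidiagonal (n + 1), x.2 * (risingBinom mu x.1 * risingBinom nu x.2) =
      ∑ x ∈ antidiagonal n, (nu + x.2) * (risingBinom mu x.1 * risingBinom nu x.2) := by
    rw [Finset.Nat.sum_antidiagonal_succ']
    simp only [Nat.cast_zero, zero_mul, zero_add]
    refine Finset.sum_congr rfl fun x _ => ?_
    have := risingBinom_succ nu x.2
    push_cast
    linear_combination risingBinom mu x.1 * this
  have h3 : (n + 1 : ℝ) * ∑ x ∈ antidiagonal (n + 1), risingBinom mu x.1 * risingBinom nu x.2 =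
      ∑ x ∈ antidiagonal (n + 1), x.1 * (risingBinom mu x.1 * risingBinom nu x.2) +
      ∑ x ∈ antidiagonal (n + 1), x.2 * (risingBinom mu x.1 * risingBinom nu x.2) := by
    rw [Finset.mul_sum, ← Finset.sum_add_distrib]
    refine Finset.sum_congr rfl fun x hx => ?_
    have : (x.1 : ℝ) + x.2 = n + 1 := by exact_mod_cast mem_antidiagonal.1 hx
    rw [← this]; ring
  rw [h3, h1, h2, Finset.mul_sum, ← Finset.sum_add_distrib]
  refine Finset.sum_congr rfl fun x hx => ?_
  have : (x.1 : ℝ) + x.2 = n := by exact_mod_cast mem_antidiagonal.1 hx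
  rw [← this]; ring

lemma sum_risingBinom_mul_neg (mu : ℝ) (n : ℕ) :
    ∑ x ∈ antidiagonal (n + 1), risingBinom mu x.1 * risingBinom (-mu) x.2 = 0 := by
  induction n with
  | zero =>
    have := sum_risingBinom_mul_succ mu (-mu) 0
    simpa using this
  | succ n ih =>
    have h := sum_risingBinom_mul_succ mu (-mu) (n + 1)
    rw [ih, mul_zero] at h
    exact (mul_eq_zero.1 h).resolve_left (by positivity)

/-- The coefficients `(λ+1)_{m-b} (λ)_b / ((m-b)! b!)` of the circle polynomials that are orthogonal
for the weight `|1 - z|^{2λ}`. -/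
def circleCoeff (lam : ℝ) (m b : ℕ) : ℝ := risingBinom (lam + 1) (m - b) * risingBinom lam b

lemma circleCoeff_pos {lam : ℝ} (h : 0 < lam) (m b : ℕ) : 0 < circleCoeff lam m b :=
  mul_pos (risingBinom_pos (by linarith) _) (risingBinom_pos h _)

lemma circleCoeff_succ_zero (lam : ℝ) (m : ℕ) :
    (m + 1) * circleCoeff lam (m + 1) 0 = (lam + m + 1) * circleCoeff lam m 0 := by
  have := risingBinom_succ (lam + 1) m
  simp only [circleCoeff, risingBinom_zero, tsub_zero]
  linear_combination this

lemma circleCoeff_succ_self (lam : ℝ) (m : ℕ) :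
    (m + 1) * circleCoeff lam (m + 1) (m + 1) = lam * circleCoeff lam m 0 := by
  have := risingBinom_succ lam m
  have h2 := risingBinom_add_one lam m
  simp only [circleCoeff, risingBinom_zero, tsub_zero, tsub_self]
  linear_combination this - h2

lemma circleCoeff_succ {lam : ℝ} (hlam : 0 < lam) (m b : ℕ) (hb : b < m) :
    (m + 1) * circleCoeff lam (m + 1) (b + 1) =
      (lam + m + 1) * circleCoeff lam m (b + 1) + lam * circleCoeff lam m (m - b) := by
  obtain ⟨a, rfl⟩ : ∃ a, m = b + a + 1 := ⟨m - b - 1, by omega⟩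
  have e1 : b + a + 1 + 1 - (b + 1) = a + 1 := by omega
  have e2 : b + a + 1 - (b + 1) = a := by omega
  have e3 : b + a + 1 - b = a + 1 := by omega
  have e4 : b + a + 1 - (a + 1) = b := by omega
  simp only [circleCoeff, e1, e2, e3, e4]
  have h1 := risingBinom_add_one lam (a + 1)
  have h2 := risingBinom_add_one lam (b + 1)
  have h3 := risingBinom_succ (lam + 1) a
  have h4 := risingBinom_succ (lam + 1) b
  push_cast at *
  set A := risingBinom (lam + 1) (a + 1)
  set B := risingBinom (lam + 1) (b + 1)
  have p1 : lam + (a + 1) ≠ 0 := by positivity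
  have p2 : lam + (b + 1) ≠ 0 := by positivity
  have q1 : risingBinom lam (a + 1) = lam * A / (lam + (a + 1)) := by
    field_simp; linear_combination -h1
  have q2 : risingBinom lam (b + 1) = lam * B / (lam + (b + 1)) := by
    field_simp; linear_combination -h2
  have q3 : risingBinom (lam + 1) a = (a + 1) * A / (lam + (a + 1)) := by
    field_simp; linear_combination -h3
  have q4 : risingBinom (lam + 1) b = (b + 1) * B / (lam + (b + 1)) := by
    field_simp; linear_combination -h4
  rw [q1, q2, q3, q4]
  field_simp
  ring

/-- The Szegő recurrence, tested against an arbitrary sequence. -/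
lemma sum_circleCoeff_succ {lam : ℝ} (hlam : 0 < lam) (m : ℕ) (g : ℕ → ℝ) :
    (m + 1) * ∑ b ∈ range (m + 2), circleCoeff lam (m + 1) b * g b =
      (lam + m + 1) * ∑ b ∈ range (m + 1), circleCoeff lam m b * g b +
      lam * ∑ b ∈ range (m + 1), circleCoeff lam m b * g (m + 1 - b) := by
  have hA : ∑ b ∈ range (m + 2), circleCoeff lam (m + 1) b * g b =
      ∑ b ∈ range m, circleCoeff lam (m + 1) (b + 1) * g (b + 1) +
      circleCoeff lam (m + 1) (m + 1) * g (m + 1) + circleCoeff lam (m + 1) 0 * g 0 := by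
    rw [Finset.sum_range_succ', Finset.sum_range_succ]
  have hB : ∑ b ∈ range (m + 1), circleCoeff lam m b * g b =
      ∑ b ∈ range m, circleCoeff lam m (b + 1) * g (b + 1) + circleCoeff lam m 0 * g 0 := by
    rw [Finset.sum_range_succ']
  have hC : ∑ b ∈ range (m + 1), circleCoeff lam m b * g (m + 1 - b) =
      ∑ b ∈ range m, circleCoeff lam m (m - b) * g (b + 1) +
        circleCoeff lam m 0 * g (m + 1) := by
    rw [← Finset.sum_range_reflect, Finset.sum_range_succ]
    simp only [add_tsub_cancel_right, tsub_self, tsub_zero]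
    congr 1
    refine Finset.sum_congr rfl fun b hb => ?_
    rw [show m + 1 - (m - b) = b + 1 by have := mem_range.1 hb; omega]
  rw [hA, hB, hC]
  have h0 := circleCoeff_succ_zero lam m
  have h1 := circleCoeff_succ_self lam m
  have h2 : (m + 1 : ℝ) * ∑ b ∈ range m, circleCoeff lam (m + 1) (b + 1) * g (b + 1) =
      (lam + m + 1) * ∑ b ∈ range m, circleCoeff lam m (b + 1) * g (b + 1) +
      lam * ∑ b ∈ range m, circleCoeff lam m (m - b) * g (b + 1) := by
    simp only [Finset.mul_sum, ← Finset.sum_add_distrib]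
    refine Finset.sum_congr rfl fun b hb => ?_
    have := circleCoeff_succ hlam m b (mem_range.1 hb)
    linear_combination g (b + 1) * this
  linear_combination h2 + g 0 * h0 + g (m + 1) * h1

section Moments

variable {lam : ℝ} {c : ℤ → ℝ}

lemma moment_eq (hrec : ∀ s : ℤ, (s + 1 + lam) * c (s + 1) = (s - lam) * c s) (n : ℕ) :
    risingBinom (lam + 1) n * c n = risingBinom (-lam) n * c 0 := by
  induction n with
  | zero => simp [risingBinom_zero]
  | succ n ih =>
    have h1 := risingBinom_succ (lam + 1) n
    have h2 := risingBinom_succ (-lam) n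
    have h3 := hrec n
    have h : (n + 1 : ℝ) ≠ 0 := by positivity
    apply mul_left_cancel₀ h
    push_cast at *
    linear_combination c (n + 1) * h1 - c 0 * h2 + risingBinom (lam + 1) n * h3 +
      (n - lam) * ih

lemma sum_circleCoeff_moment_self
    (hrec : ∀ s : ℤ, (s + 1 + lam) * c (s + 1) = (s - lam) * c s)
    (hev : ∀ s, c (-s) = c s) (m : ℕ) :
    ∑ b ∈ range (m + 2), circleCoeff lam (m + 1) b * c ((b : ℤ) - (m + 1 : ℕ)) = 0 := by
  have h := sum_risingBinom_mul_neg lam m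
  rw [Finset.Nat.sum_antidiagonal_eq_sum_range_succ
    (fun i j => risingBinom lam i * risingBinom (-lam) j)] at h
  rw [← mul_zero (c 0), ← h, Finset.mul_sum]
  refine Finset.sum_congr rfl fun b hb => ?_
  have hb' : b ≤ m + 1 := by have := mem_range.1 hb; omega
  have e : c ((b : ℤ) - (m + 1 : ℕ)) = c ((m + 1 - b : ℕ) : ℤ) := by
    rw [← hev]; congr 1; push_cast [Nat.cast_sub hb']; ring
  have := moment_eq hrec (m + 1 - b)
  rw [e, circleCoeff]
  linear_combination risingBinom lam b * this

/-- The circle polynomials are orthogonal, with an explicit norm. -/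
lemma sum_circleCoeff_moment (hlam : 0 < lam)
    (hrec : ∀ s : ℤ, (s + 1 + lam) * c (s + 1) = (s - lam) * c s)
    (hev : ∀ s, c (-s) = c s) (m : ℕ) :
    (∀ i : ℕ, 1 ≤ i → i ≤ m →
      ∑ b ∈ range (m + 1), circleCoeff lam m b * c ((b : ℤ) - i) = 0) ∧
    risingBinom (lam + 1) m * ∑ b ∈ range (m + 1), circleCoeff lam m b * c b =
      (∑ b ∈ range (m + 1), circleCoeff lam m b) * c 0 := by
  induction m with
  | zero => exact ⟨fun i h1 h2 => by omega, by simp [circleCoeff, risingBinom_zero]⟩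
  | succ m ih =>
    obtain ⟨ih1, ih2⟩ := ih
    have hm : (m + 1 : ℝ) ≠ 0 := by positivity
    have key : ∀ i : ℕ, i ≤ m + 1 →
        (m + 1) * ∑ b ∈ range (m + 2), circleCoeff lam (m + 1) b * c ((b : ℤ) - i) =
        (lam + m + 1) * ∑ b ∈ range (m + 1), circleCoeff lam m b * c ((b : ℤ) - i) +
        lam * ∑ b ∈ range (m + 1), circleCoeff lam m b * c ((b : ℤ) - (m + 1 - i : ℕ)) := by
      intro i hi
      rw [sum_circleCoeff_succ hlam m (fun b => c ((b : ℤ) - i))]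
      congr 2
      refine Finset.sum_congr rfl fun b hb => ?_
      have hb' : b ≤ m + 1 := by have := mem_range.1 hb; omega
      rw [← hev]
      congr 2
      push_cast [Nat.cast_sub hb', Nat.cast_sub hi]
      ring
    constructor
    · intro i h1 h2
      rcases Nat.lt_or_ge m i with h | h
      · obtain rfl : i = m + 1 := by omega
        exact sum_circleCoeff_moment_self hrec hev m
      · have := key i h2
        rw [ih1 i h1 h, ih1 (m + 1 - i) (by omega) (by omega), mul_zero, mul_zero, add_zero] at this
        exact (mul_eq_zero.1 this).resolve_left hm
    · have k0 := key 0 (by omega)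
      have k1 := key (m + 1) le_rfl
      rw [sum_circleCoeff_moment_self hrec hev m] at k1
      have kY := sum_circleCoeff_succ hlam m (fun _ => 1)
      have h3 := risingBinom_succ (lam + 1) m
      simp only [Nat.cast_zero, sub_zero, tsub_zero, tsub_self, mul_one, mul_zero] at k0 k1 kY
      set X := ∑ b ∈ range (m + 1), circleCoeff lam m b * c b
      set Z := ∑ b ∈ range (m + 1), circleCoeff lam m b * c ((b : ℤ) - (m + 1 : ℕ))
      have hl : lam + m + 1 ≠ 0 := by positivity
      apply mul_left_cancel₀ (mul_ne_zero hm hm)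
      have e : (m + 1 : ℝ) * ∑ b ∈ range (m + 2), circleCoeff lam (m + 1) b * c b =
          (lam + m + 1) * X + lam * Z := k0
      have k2 : (lam + m + 1) * Z = -lam * X := by linear_combination -k1
      have : risingBinom (lam + 1) m * ((lam + m + 1) * ((lam + m + 1) * X + lam * Z)) =
          (m + 1) * ((2 * lam + m + 1) *
            ((∑ b ∈ range (m + 1), circleCoeff lam m b) * c 0)) := by
        linear_combination risingBinom (lam + 1) m * lam * k2 + (m + 1) * (2 * lam + m + 1) * ih2
      linear_combination (m + 1) * risingBinom (lam + 1) (m + 1) * e +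
        ((lam + m + 1) * X + lam * Z) * h3 + this - (m + 1) * c 0 * kY

end Moments

/-- The dihedral weight `|sin kθ|^{2λ}` on the circle. -/
def dihedralWeight (lam : ℝ) (k : ℕ) (θ : ℝ) : ℝ := |Real.sin (k * θ)| ^ (2 * lam)

/-- The cosine moments of the dihedral weight. -/
def dihedralMoment (lam : ℝ) (k : ℕ) (l : ℤ) : ℝ :=
  ∫ θ in (0 : ℝ)..π, Real.cos (l * θ) * dihedralWeight lam k θ

lemma continuous_dihedralWeight {lam : ℝ} (hlam : 0 < lam) (k : ℕ) :
    Continuous (dihedralWeight lam k) := by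
  unfold dihedralWeight
  exact Continuous.rpow_const (by fun_prop) fun _ => Or.inr (by positivity)

lemma dihedralWeight_nonneg (lam : ℝ) (k : ℕ) (θ : ℝ) : 0 ≤ dihedralWeight lam k θ := by
  unfold dihedralWeight; positivity

lemma dihedralWeight_pi_sub (lam : ℝ) (k : ℕ) (θ : ℝ) :
    dihedralWeight lam k (π - θ) = dihedralWeight lam k θ := by
  rw [dihedralWeight, mul_sub, Real.sin_nat_mul_pi_sub, dihedralWeight]
  simp [abs_mul]

lemma dihedralWeight_add {lam : ℝ} {k : ℕ} (hk : 0 < k) (θ : ℝ) :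
    dihedralWeight lam k (θ + π / k) = dihedralWeight lam k θ := by
  have : (k : ℝ) * (θ + π / k) = k * θ + π := by field_simp
  rw [dihedralWeight, this, Real.sin_add_pi, abs_neg, dihedralWeight]

lemma dihedralMoment_neg (lam : ℝ) (k : ℕ) (l : ℤ) :
    dihedralMoment lam k (-l) = dihedralMoment lam k l := by
  simp [dihedralMoment]

lemma dihedralMoment_of_odd (lam : ℝ) (k : ℕ) {l : ℤ} (hl : Odd l) :
    dihedralMoment lam k l = 0 := by
  have h : dihedralMoment lam k l = -dihedralMoment lam k l := by
    conv_lhs => rw [dihedralMoment]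
    have := intervalIntegral.integral_comp_sub_left (a := 0) (b := π)
      (fun θ => Real.cos (l * θ) * dihedralWeight lam k θ) π
    rw [sub_self, sub_zero] at this
    rw [← this, dihedralMoment, ← intervalIntegral.integral_neg]
    congr 1
    ext θ
    rw [dihedralWeight_pi_sub, mul_sub, Real.cos_int_mul_pi_sub, hl.neg_one_zpow]
    ring
  linarith

lemma dihedralMoment_of_not_dvd {lam : ℝ} (hlam : 0 < lam) {k : ℕ} (hk : 0 < k) {l : ℤ}
    (hl : ¬ (2 * k : ℤ) ∣ l) : dihedralMoment lam k l = 0 := by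
  rcases Int.even_or_odd l with he | ho
  swap
  · exact dihedralMoment_of_odd lam k ho
  obtain ⟨j, rfl⟩ := he
  have hk' : (k : ℝ) ≠ 0 := by positivity
  set f : ℝ → ℝ := fun θ => Real.cos ((j + j : ℤ) * θ) * dihedralWeight lam k θ with hf
  have hper : Function.Periodic f π := by
    intro θ
    have h1 : ((j + j : ℤ) : ℝ) * (θ + π) = (j + j : ℤ) * θ + j * (2 * π) := by push_cast; ring
    have h2 : (k : ℝ) * (θ + π) = k * θ + k * π := by ring
    simp only [hf, dihedralWeight, h1, h2, Real.cos_add_int_mul_two_pi, Real.sin_add_nat_mul_pi]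
    simp [abs_mul]
  have hcont : Continuous f := by
    have := continuous_dihedralWeight hlam k
    fun_prop
  have h1 : ∫ θ in (0 : ℝ)..π, f (θ + π / k) = dihedralMoment lam k (j + j) := by
    rw [intervalIntegral.integral_comp_add_right f, zero_add, add_comm π,
      hper.intervalIntegral_add_eq _ 0, zero_add]
    rfl
  have h2 : ∫ θ in (0 : ℝ)..π, f (θ - π / k) = dihedralMoment lam k (j + j) := by
    rw [intervalIntegral.integral_comp_sub_right f, zero_sub, sub_eq_neg_add π,
      hper.intervalIntegral_add_eq _ 0, zero_add]
    rfl
  have h3 : ∀ θ, f (θ + π / k) + f (θ - π / k) =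
      2 * Real.cos ((j + j : ℤ) * (π / k)) * f θ := by
    intro θ
    have e1 := dihedralWeight_add (lam := lam) hk θ
    have e2 := dihedralWeight_add (lam := lam) hk (θ - π / k)
    rw [sub_add_cancel] at e2
    simp only [hf, e1, ← e2, mul_add, mul_sub, Real.cos_add, Real.cos_sub]
    ring
  have h4 : 2 * dihedralMoment lam k (j + j) =
      2 * Real.cos ((j + j : ℤ) * (π / k)) * dihedralMoment lam k (j + j) := by
    calc 2 * dihedralMoment lam k (j + j)
        = (∫ θ in (0 : ℝ)..π, f (θ + π / k)) + ∫ θ in (0 : ℝ)..π, f (θ - π / k) := by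
          rw [h1, h2]; ring
      _ = ∫ θ in (0 : ℝ)..π, 2 * Real.cos ((j + j : ℤ) * (π / k)) * f θ := by
          rw [← intervalIntegral.integral_add
            (Continuous.intervalIntegrable (by fun_prop) _ _)
            (Continuous.intervalIntegrable (by fun_prop) _ _)]
          simp only [h3]
      _ = _ := by rw [intervalIntegral.integral_const_mul]; rfl
  by_contra hne
  have h5 : Real.cos ((j + j : ℤ) * (π / k)) = 1 := by
    have : dihedralMoment lam k (j + j) * (Real.cos ((j + j : ℤ) * (π / k)) - 1) = 0 := by
      linarith
    linarith [(mul_eq_zero.1 this).resolve_left hne]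
  obtain ⟨n, hn⟩ := (Real.cos_eq_one_iff _).1 h5
  have h6 : (n * k : ℝ) = j := by
    push_cast at hn
    field_simp at hn
    linarith
  apply hl
  refine ⟨n, ?_⟩
  have : n * k = j := by exact_mod_cast h6
  rw [← this]; ring

lemma hasDerivAt_abs_rpow_mul_self {p : ℝ} (hp : 0 < p) (x : ℝ) :
    HasDerivAt (fun x : ℝ => |x| ^ p * x) ((p + 1) * |x| ^ p) x := by
  have hc : Continuous fun x : ℝ => |x| ^ p :=
    Continuous.rpow_const (by fun_prop) fun _ => Or.inr hp.le
  refine hasDerivAt_of_hasDerivAt_of_ne' (x := 0) (g := fun x => (p + 1) * |x| ^ p)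
    (fun y hy => ?_) (hc.mul continuous_id).continuousAt (continuous_const.mul hc).continuousAt x
  have h := ((hasDerivAt_abs hy).rpow_const (p := p) (Or.inl (abs_ne_zero.2 hy))).mul
    (hasDerivAt_id' y)
  convert! h using 1
  have h1 : |y| ^ p = |y| ^ (p - 1) * |y| := by
    rw [← Real.rpow_add_one (abs_ne_zero.2 hy), sub_add_cancel]
  have h2 : (SignType.sign y : ℝ) * y = |y| := sign_mul_self y
  rw [h1]
  linear_combination (-p * |y| ^ (p - 1)) * h2

lemma dihedralMoment_succ {lam : ℝ} (hlam : 0 < lam) {k : ℕ} (hk : 0 < k) (s : ℤ) :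
    (s + 1 + lam) * dihedralMoment lam k (2 * k * (s + 1)) =
      (s - lam) * dihedralMoment lam k (2 * k * s) := by
  have hk' : (k : ℝ) ≠ 0 := by positivity
  have hW := continuous_dihedralWeight hlam k
  have hderiv : ∀ θ : ℝ, HasDerivAt
      (fun θ : ℝ => (|Real.sin (k * θ)| ^ (2 * lam) * Real.sin (k * θ)) *
        Real.cos ((2 * s + 1) * (k * θ)))
      (k * ((s + 1 + lam) * (Real.cos ((2 * k * (s + 1) : ℤ) * θ) * dihedralWeight lam k θ) -
        (s - lam) * (Real.cos ((2 * k * s : ℤ) * θ) * dihedralWeight lam k θ))) θ := by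
    intro θ
    have hlin : HasDerivAt (fun θ : ℝ => (k : ℝ) * θ) k θ := by
      simpa using (hasDerivAt_id θ).const_mul (k : ℝ)
    have hlin2 : HasDerivAt (fun θ : ℝ => (2 * s + 1 : ℝ) * (k * θ)) ((2 * s + 1) * k) θ :=
      hlin.const_mul _
    have h1 := (hasDerivAt_abs_rpow_mul_self (p := 2 * lam) (by positivity)
      (Real.sin (k * θ))).comp θ hlin.sin
    convert! h1.mul hlin2.cos using 1
    have e1 : ((2 * k * (s + 1) : ℤ) : ℝ) * θ = (2 * s + 1) * (k * θ) + k * θ := by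
      push_cast; ring
    have e2 : ((2 * k * s : ℤ) : ℝ) * θ = (2 * s + 1) * (k * θ) - k * θ := by
      push_cast; ring
    simp only [Function.comp_apply]
    rw [e1, e2, Real.cos_add, Real.cos_sub, dihedralWeight]
    ring
  have hint := intervalIntegral.integral_eq_sub_of_hasDerivAt (a := 0) (b := π)
    (fun θ _ => hderiv θ) (Continuous.intervalIntegrable (by fun_prop) _ _)
  rw [intervalIntegral.integral_const_mul, intervalIntegral.integral_sub
    (Continuous.intervalIntegrable (by fun_prop) _ _)
    (Continuous.intervalIntegrable (by fun_prop) _ _), intervalIntegral.integral_const_mul,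
    intervalIntegral.integral_const_mul] at hint
  simp only [Real.sin_nat_mul_pi, mul_zero, Real.sin_zero, zero_mul, sub_zero] at hint
  have := (mul_eq_zero.1 hint).resolve_left hk'
  exact sub_eq_zero.1 this

lemma dihedralMoment_zero_pos {lam : ℝ} (hlam : 0 < lam) {k : ℕ} (hk : 0 < k) :
    0 < dihedralMoment lam k 0 := by
  have hW := continuous_dihedralWeight hlam k
  have hk' : (1 : ℝ) ≤ k := by exact_mod_cast hk
  refine intervalIntegral.integral_pos Real.pi_pos (by fun_prop)
    (fun θ _ => by simpa using dihedralWeight_nonneg lam k θ)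
    ⟨π / 2 / k, ⟨by positivity, ?_⟩, ?_⟩
  · rw [div_le_iff₀ (by positivity)]; nlinarith [Real.pi_pos]
  · have : (k : ℝ) * (π / 2 / k) = π / 2 := by field_simp
    simp [dihedralWeight, this]

/-- A linear functional annihilating the first `n` members of a polynomial sequence annihilates all
polynomials of degree less than `n`. -/
lemma map_eq_zero_of_degree_lt {B : ℝ[X] →ₗ[ℝ] ℝ} {T : ℕ → ℝ[X]}
    (hT : ∀ n : ℕ, (T n).degree = n) {n : ℕ} (h : ∀ l < n, B (T l) = 0) {f : ℝ[X]}
    (hf : f.degree < n) : B f = 0 := by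
  let S : Polynomial.Sequence ℝ := ⟨T, hT⟩
  have hspan := S.span_degreeLT (m := n) fun i _ =>
    (Polynomial.leadingCoeff_ne_zero.2 (S.ne_zero i)).isUnit
  have hmem : f ∈ Submodule.span ℝ (S '' Set.Iio n) := by
    rw [hspan]; exact Polynomial.mem_degreeLT.2 hf
  have hle : Submodule.span ℝ (S '' Set.Iio n) ≤ LinearMap.ker B := by
    rw [Submodule.span_le]
    rintro _ ⟨l, hl, rfl⟩
    exact h l hl
  exact hle hmem

/-- The normalized product `q_n(x) q_n(y) / B(q_n²)` may be computed from any polynomial of degree at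
most `n` orthogonal to all polynomials of lower degree. -/
lemma eval_mul_eval_div_eq_of_orthogonal {B : ℝ[X] →ₗ[ℝ] ℝ}
    (hpos : ∀ f : ℝ[X], f ≠ 0 → 0 < B (f * f)) {q T : ℕ → ℝ[X]}
    (hq : ∀ n : ℕ, (q n).degree = n) (horth : ∀ n m : ℕ, n ≠ m → B (q n * q m) = 0)
    (hT : ∀ n : ℕ, (T n).degree = n) {n : ℕ} {P : ℝ[X]} (hdeg : P.degree ≤ n)
    (hP : ∀ l < n, B (P * T l) = 0) (hne : B (P * P) ≠ 0) (x y : ℝ) :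
    (q n).eval x * (q n).eval y / B (q n * q n) = P.eval x * P.eval y / B (P * P) := by
  have hqn : q n ≠ 0 := Polynomial.degree_ne_bot.1 (by simp [hq n])
  have hQ := (hpos _ hqn).ne'
  set d := B (P * q n) / B (q n * q n) with hd
  set δ := P - d • q n with hδ
  have hPlow : ∀ l < n, B (P * q l) = 0 := by
    intro l hl
    exact map_eq_zero_of_degree_lt (B := B ∘ₗ LinearMap.mulLeft ℝ P) hT
      (fun i hi => by simpa using hP i hi) (by rw [hq l]; exact_mod_cast hl)
  have hδorth : ∀ l < n + 1, B (δ * q l) = 0 := by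
    intro l hl
    rw [hδ, sub_mul, smul_mul_assoc, map_sub, map_smul, smul_eq_mul]
    rcases Nat.lt_succ_iff_lt_or_eq.1 hl with h | rfl
    · rw [hPlow l h, horth n l h.ne', mul_zero, sub_zero]
    · rw [hd, div_mul_cancel₀ _ hQ, sub_self]
  have hδdeg : δ.degree < (n + 1 : ℕ) := by
    have h1 : δ.degree ≤ n :=
      (Polynomial.degree_sub_le _ _).trans
        (max_le hdeg ((Polynomial.degree_smul_le _ _).trans (hq n).le))
    exact h1.trans_lt (by exact_mod_cast Nat.lt_succ_self n)
  have hδ0 : δ = 0 := by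
    by_contra hne0
    refine (hpos δ hne0).ne' ?_
    exact map_eq_zero_of_degree_lt (B := B ∘ₗ LinearMap.mulLeft ℝ δ) hq
      (fun i hi => by simpa using hδorth i hi) hδdeg
  have hPq : P = d • q n := sub_eq_zero.1 hδ0
  have hPP : B (P * P) = d * d * B (q n * q n) := by
    rw [hPq, smul_mul_smul_comm, map_smul, smul_eq_mul]
  have hd0 : d ≠ 0 := by
    intro h0
    rw [hPP, h0] at hne
    simp at hne
  rw [hPP, hPq]
  simp only [Polynomial.eval_smul, smul_eq_mul]
  field_simp

/-- Integration of `p(cos θ)` against a continuous density on `[0, π]`. -/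
def cosFunctional (v : ℝ → ℝ) (hv : Continuous v) : ℝ[X] →ₗ[ℝ] ℝ where
  toFun p := ∫ θ in (0 : ℝ)..π, p.eval (Real.cos θ) * v θ
  map_add' p q := by
    simp only [Polynomial.eval_add, add_mul]
    exact intervalIntegral.integral_add (Continuous.intervalIntegrable (by fun_prop) _ _)
      (Continuous.intervalIntegrable (by fun_prop) _ _)
  map_smul' a p := by
    simp only [Polynomial.eval_smul, smul_eq_mul, mul_assoc, RingHom.id_apply]
    exact intervalIntegral.integral_const_mul _ _

lemma cosFunctional_apply (v : ℝ → ℝ) (hv : Continuous v) (p : ℝ[X]) :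
    cosFunctional v hv p = ∫ θ in (0 : ℝ)..π, p.eval (Real.cos θ) * v θ := rfl

lemma cosFunctional_mul_self_pos {v : ℝ → ℝ} (hv : Continuous v) (hv0 : ∀ θ, 0 ≤ v θ) {ε : ℝ}
    (hε : 0 < ε) (hεπ : ε ≤ π) (hvε : ∀ θ ∈ Set.Ioo 0 ε, 0 < v θ) {f : ℝ[X]} (hf : f ≠ 0) :
    0 < cosFunctional v hv (f * f) := by
  have hex : ∃ θ ∈ Set.Ioo 0 ε, f.eval (Real.cos θ) ≠ 0 := by
    by_contra! hall
    refine hf (Polynomial.eq_zero_of_infinite_isRoot f ?_)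
    have hinj : Set.InjOn Real.cos (Set.Ioo 0 ε) :=
      Real.injOn_cos.mono (Set.Ioo_subset_Icc_self.trans (Set.Icc_subset_Icc_right hεπ))
    refine ((Set.Ioo_infinite hε).image hinj).mono ?_
    rintro _ ⟨θ, hθ, rfl⟩
    exact hall θ hθ
  obtain ⟨θ, hθ, hne⟩ := hex
  rw [cosFunctional_apply]
  simp only [Polynomial.eval_mul]
  refine intervalIntegral.integral_pos Real.pi_pos (by fun_prop)
    (fun x _ => mul_nonneg (mul_self_nonneg _) (hv0 x)) ⟨θ, ⟨hθ.1.le, hθ.2.le.trans hεπ⟩, ?_⟩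
  exact mul_pos (mul_self_pos.2 hne) (hvε θ hθ)

lemma abs_chebU_mul_sin (k : ℕ) {θ : ℝ} (hθ : 0 ≤ Real.sin θ) :
    |chebU ((k : ℤ) - 1) (Real.cos θ)| * Real.sin θ = |Real.sin (k * θ)| := by
  have h := Polynomial.Chebyshev.U_real_cos θ ((k : ℤ) - 1)
  nth_rewrite 1 [← abs_of_nonneg hθ]
  rw [chebU, ← abs_mul, h]
  push_cast
  ring_nf

lemma integral_mul_wminus (lam : ℝ) (k : ℕ) (g : ℝ → ℝ) :
    ∫ t in (-1 : ℝ)..1, g t * wminus lam k t =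
      ∫ θ in (0 : ℝ)..π, g (Real.cos θ) * dihedralWeight lam k θ := by
  have h := Polynomial.Chebyshev.integral_measureT_eq_integral_cos (f := fun t =>
    g t * (|chebU ((k : ℤ) - 1) t| ^ (2 * lam) * (1 - t ^ 2) ^ lam))
  rw [Polynomial.Chebyshev.integral_measureT] at h
  calc _ = _ := ?_
    _ = _ := h
    _ = _ := ?_
  · refine intervalIntegral.integral_congr_Ioo_of_le (by norm_num) fun t ht => ?_
    have ht' : 0 < 1 - t ^ 2 := by nlinarith [ht.1, ht.2]
    simp only [wminus]
    rw [Real.rpow_sub ht', ← Real.sqrt_eq_rpow, Real.sqrt_inv]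
    ring
  · refine intervalIntegral.integral_congr_Ioo_of_le Real.pi_pos.le fun θ hθ => ?_
    have hs : 0 ≤ Real.sin θ := (Real.sin_pos_of_mem_Ioo hθ).le
    simp only [dihedralWeight, ← abs_chebU_mul_sin k hs, ← Real.sin_sq]
    rw [Real.mul_rpow (abs_nonneg _) hs, Real.rpow_mul hs]
    norm_num

lemma integral_mul_wplus (lam : ℝ) (k : ℕ) (g : ℝ → ℝ) :
    ∫ t in (-1 : ℝ)..1, g t * wplus lam k t =
      ∫ θ in (0 : ℝ)..π, g (Real.cos θ) * (Real.sin θ ^ 2 * dihedralWeight lam k θ) := by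
  have h := integral_mul_wminus lam k fun t => g t * (1 - t ^ 2)
  simp only [← Real.sin_sq, mul_assoc] at h
  rw [← h]
  refine intervalIntegral.integral_congr_Ioo_of_le (by norm_num) fun t ht => ?_
  have ht' : 0 < 1 - t ^ 2 := by nlinarith [ht.1, ht.2]
  simp only [wplus, wminus]
  rw [show lam + 1 / 2 = lam - 1 / 2 + 1 by ring, Real.rpow_add_one ht'.ne']
  ring

section DihedralPolynomials

variable (lam : ℝ) (k n : ℕ)

/-- The even `h`-harmonic of degree `n`, as a polynomial in `cos θ`. -/
def dihedralCosPoly : ℝ[X] :=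
  ∑ b ∈ range (n / k + 1), circleCoeff lam (n / k) b • Polynomial.Chebyshev.T ℝ (n - 2 * k * b)

/-- The odd `h`-harmonic of degree `n`, divided by `sin θ`, as a polynomial in `cos θ`. -/
def dihedralSinPoly : ℝ[X] :=
  ∑ b ∈ range (n / k + 1),
    circleCoeff lam (n / k) b • Polynomial.Chebyshev.U ℝ (n - 2 * k * b - 1)

/-- The common value at `θ = 0` of the sum of coefficients. -/
def dihedralCoeffSum : ℝ := ∑ b ∈ range (n / k + 1), circleCoeff lam (n / k) b

/-- The defect between the norms of the even and the odd `h`-harmonic of degree `n`. -/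
def dihedralDefect : ℝ := if k ∣ n then lam / (lam + (n / k : ℕ)) else 0

/-- Pairing of the complex `h`-harmonic of degree `n` with `e^{ilθ}`. -/
def dihedralPairing (l : ℤ) : ℝ :=
  ∑ b ∈ range (n / k + 1), circleCoeff lam (n / k) b * dihedralMoment lam k (n - 2 * k * b - l)

variable {lam k}

lemma dihedralCoeffSum_pos (hlam : 0 < lam) : 0 < dihedralCoeffSum lam k n :=
  Finset.sum_pos (fun _ _ => circleCoeff_pos hlam _ _) (by simp)

lemma dihedralDefect_nonneg (hlam : 0 < lam) : 0 ≤ dihedralDefect lam k n := by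
  unfold dihedralDefect; split_ifs <;> positivity

lemma eval_dihedralCosPoly (θ : ℝ) : (dihedralCosPoly lam k n).eval (Real.cos θ) =
    ∑ b ∈ range (n / k + 1), circleCoeff lam (n / k) b * Real.cos ((n - 2 * k * b) * θ) := by
  simp only [dihedralCosPoly, Polynomial.eval_finsetSum, Polynomial.eval_smul, smul_eq_mul,
    Polynomial.Chebyshev.T_real_cos]
  push_cast
  rfl

lemma eval_dihedralSinPoly_mul_sin (θ : ℝ) :
    (dihedralSinPoly lam k n).eval (Real.cos θ) * Real.sin θ =
    ∑ b ∈ range (n / k + 1), circleCoeff lam (n / k) b * Real.sin ((n - 2 * k * b) * θ) := by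
  simp only [dihedralSinPoly, Polynomial.eval_finsetSum, Polynomial.eval_smul, smul_eq_mul,
    Finset.sum_mul, mul_assoc, Polynomial.Chebyshev.U_real_cos]
  push_cast
  simp only [sub_add_cancel]

lemma natAbs_sub_le {b : ℕ} (hb : b ∈ range (n / k + 1)) :
    ((n : ℤ) - 2 * k * b).natAbs ≤ n := by
  have h1 : b ≤ n / k := by have := mem_range.1 hb; omega
  have h2 : k * b ≤ n := (Nat.mul_le_mul_left k h1).trans (Nat.mul_div_le n k)
  have h3 : (k * b : ℤ) ≤ n := by exact_mod_cast h2
  have h4 : (0 : ℤ) ≤ k * b := by positivity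
  have : (2 * k * b : ℤ) = 2 * (k * b) := by ring
  omega

lemma degree_dihedralCosPoly_le : (dihedralCosPoly lam k n).degree ≤ n := by
  refine (Polynomial.degree_sum_le _ _).trans (Finset.sup_le fun b hb => ?_)
  refine (Polynomial.degree_smul_le _ _).trans ?_
  rw [Polynomial.Chebyshev.degree_T]
  exact_mod_cast natAbs_sub_le n hb

lemma degree_dihedralSinPoly_le : (dihedralSinPoly lam k (n + 1)).degree ≤ n := by
  refine (Polynomial.degree_sum_le _ _).trans (Finset.sup_le fun b hb => ?_)
  refine (Polynomial.degree_smul_le _ _).trans (Polynomial.degree_le_of_natDegree_le ?_)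
  rw [Polynomial.Chebyshev.natDegree_U]
  have := natAbs_sub_le (n + 1) hb
  omega

variable {n}

lemma dihedralPairing_eq_zero (hlam : 0 < lam) (hk : 0 < k) {l : ℤ} (h1 : -(n : ℤ) < l) (h2 : l < n) :
    dihedralPairing lam k n l = 0 := by
  by_cases hd : (2 * k : ℤ) ∣ n - l
  · obtain ⟨i, hi⟩ := hd
    have hk' : (0 : ℤ) < 2 * k := by positivity
    have hi1 : 0 < i := by
      by_contra hcon
      nlinarith
    have hi2 : i < (n / k : ℕ) + 1 := by
      have h3 : n < k * (n / k + 1) := Nat.lt_mul_div_succ n hk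
      have h4 : (n : ℤ) < k * ((n / k : ℕ) + 1) := by exact_mod_cast h3
      by_contra hcon
      nlinarith
    lift i to ℕ using hi1.le
    rw [← (sum_circleCoeff_moment (c := fun s => dihedralMoment lam k (2 * k * s)) hlam
      (dihedralMoment_succ hlam hk) (fun s => by rw [mul_neg, dihedralMoment_neg]) (n / k)).1 i
      (by exact_mod_cast hi1) (by omega)]
    refine Finset.sum_congr rfl fun b _ => ?_
    rw [← dihedralMoment_neg]
    congr 2
    linear_combination -hi
  · refine Finset.sum_eq_zero fun b _ => ?_
    rw [dihedralMoment_of_not_dvd hlam hk, mul_zero]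
    rintro ⟨i, hi⟩
    exact hd ⟨i + b, by linear_combination hi⟩

lemma sum_dihedralPairing (hlam : 0 < lam) (hk : 0 < k) :
    ∑ b ∈ range (n / k + 1), circleCoeff lam (n / k) b *
    dihedralPairing lam k n (n - 2 * k * b) =
      dihedralCoeffSum lam k n * dihedralMoment lam k 0 := by
  obtain ⟨h1, h2⟩ := sum_circleCoeff_moment (c := fun s => dihedralMoment lam k (2 * k * s)) hlam
    (dihedralMoment_succ hlam hk) (fun s => by rw [mul_neg, dihedralMoment_neg]) (n / k)
  have key : ∀ b' : ℕ, dihedralPairing lam k n (n - 2 * k * b') =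
      ∑ b ∈ range (n / k + 1), circleCoeff lam (n / k) b *
        dihedralMoment lam k (2 * k * ((b : ℤ) - b')) := by
    intro b'
    refine Finset.sum_congr rfl fun b _ => ?_
    rw [← dihedralMoment_neg]
    congr 2
    ring
  rw [Finset.sum_eq_single_of_mem 0 (by simp)]
  · simp only [mul_zero] at h2
    rw [key, dihedralCoeffSum, ← h2]
    simp [circleCoeff, risingBinom_zero]
  · intro b hb hb0
    rw [key, h1 b (by omega) (by have := mem_range.1 hb; omega), mul_zero]

lemma sum_dihedralPairing_neg (hlam : 0 < lam) (hk : 0 < k) :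
    ∑ b ∈ range (n / k + 1), circleCoeff lam (n / k) b *
    dihedralPairing lam k n (-(n - 2 * k * b)) =
      dihedralDefect lam k n * (dihedralCoeffSum lam k n * dihedralMoment lam k 0) := by
  rw [dihedralDefect]
  split_ifs with hd
  · obtain ⟨h1, h2⟩ := sum_circleCoeff_moment (c := fun s => dihedralMoment lam k (2 * k * s)) hlam
      (dihedralMoment_succ hlam hk) (fun s => by rw [mul_neg, dihedralMoment_neg]) (n / k)
    obtain ⟨m, rfl⟩ := hd
    rw [dihedralCoeffSum]
    rw [Nat.mul_div_cancel_left m hk] at *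
    have key : ∀ b' ∈ range (m + 1),
        dihedralPairing lam k (k * m) (-((k * m : ℕ) - 2 * k * b')) =
        ∑ b ∈ range (m + 1), circleCoeff lam m b *
          dihedralMoment lam k (2 * k * ((b : ℤ) - (m - b' : ℕ))) := by
      intro b' hb'
      have hle : b' ≤ m := by have := mem_range.1 hb'; omega
      rw [dihedralPairing, Nat.mul_div_cancel_left m hk]
      refine Finset.sum_congr rfl fun b _ => ?_
      rw [← dihedralMoment_neg]
      congr 2
      push_cast [Nat.cast_sub hle]
      ring
    rw [Finset.sum_eq_single_of_mem m (by simp)]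
    · simp only [mul_zero] at h2
      rw [key m (by simp), ← h2]
      have e : circleCoeff lam m m = risingBinom lam m := by simp [circleCoeff, risingBinom_zero]
      rw [e, tsub_self]
      simp only [Nat.cast_zero, sub_zero]
      set X := ∑ b ∈ range (m + 1), circleCoeff lam m b * dihedralMoment lam k (2 * k * b)
      have := risingBinom_add_one lam m
      have hne : lam + m ≠ 0 := by positivity
      field_simp
      linear_combination -X * this
    · intro b hb hbm
      have := mem_range.1 hb
      rw [key b hb, h1 (m - b) (by omega) (by omega), mul_zero]
  · rw [zero_mul]
    refine Finset.sum_eq_zero fun b' _ => ?_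
    rw [dihedralPairing, Finset.sum_eq_zero, mul_zero]
    intro b _
    rw [dihedralMoment_of_not_dvd hlam hk, mul_zero]
    rintro ⟨i, hi⟩
    refine hd ?_
    have : (k : ℤ) ∣ n := ⟨i + b + b', by linarith⟩
    exact_mod_cast this

/-- The functional `p ↦ ∫ p w⁻`. -/
def evenFunctional (hlam : 0 < lam) (k : ℕ) : ℝ[X] →ₗ[ℝ] ℝ :=
  cosFunctional (dihedralWeight lam k) (continuous_dihedralWeight hlam k)

/-- The functional `p ↦ ∫ p w⁺`. -/
def oddFunctional (hlam : 0 < lam) (k : ℕ) : ℝ[X] →ₗ[ℝ] ℝ :=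
  cosFunctional (fun θ => Real.sin θ ^ 2 * dihedralWeight lam k θ)
    ((Real.continuous_sin.pow 2).mul (continuous_dihedralWeight hlam k))

lemma evenFunctional_T_mul_T (hlam : 0 < lam) (a b : ℤ) :
    evenFunctional hlam k (Polynomial.Chebyshev.T ℝ a * Polynomial.Chebyshev.T ℝ b) =
      (dihedralMoment lam k (a - b) + dihedralMoment lam k (a - -b)) / 2 := by
  have hW := continuous_dihedralWeight hlam k
  rw [evenFunctional, cosFunctional_apply, dihedralMoment, dihedralMoment,
    ← intervalIntegral.integral_add (Continuous.intervalIntegrable (by fun_prop) _ _)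
    (Continuous.intervalIntegrable (by fun_prop) _ _), ← intervalIntegral.integral_div]
  congr 1
  ext θ
  rw [Polynomial.eval_mul, Polynomial.Chebyshev.T_real_cos, Polynomial.Chebyshev.T_real_cos]
  push_cast
  rw [sub_neg_eq_add, sub_mul, add_mul, Real.cos_sub, Real.cos_add]
  ring

lemma oddFunctional_U_mul_U (hlam : 0 < lam) (a b : ℤ) :
    oddFunctional hlam k (Polynomial.Chebyshev.U ℝ (a - 1) * Polynomial.Chebyshev.U ℝ (b - 1)) =
      (dihedralMoment lam k (a - b) - dihedralMoment lam k (a - -b)) / 2 := by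
  have hW := continuous_dihedralWeight hlam k
  rw [oddFunctional, cosFunctional_apply, dihedralMoment, dihedralMoment,
    ← intervalIntegral.integral_sub (Continuous.intervalIntegrable (by fun_prop) _ _)
    (Continuous.intervalIntegrable (by fun_prop) _ _), ← intervalIntegral.integral_div]
  congr 1
  ext θ
  have ha := Polynomial.Chebyshev.U_real_cos θ (a - 1)
  have hb := Polynomial.Chebyshev.U_real_cos θ (b - 1)
  push_cast at ha hb ⊢
  rw [sub_add_cancel] at ha hb
  rw [Polynomial.eval_mul, sub_neg_eq_add, sub_mul, add_mul, Real.cos_sub, Real.cos_add, ← ha, ← hb]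
  ring

lemma evenFunctional_dihedralCosPoly_mul_T (hlam : 0 < lam) (l : ℤ) :
    evenFunctional hlam k (dihedralCosPoly lam k n * Polynomial.Chebyshev.T ℝ l) =
      (dihedralPairing lam k n l + dihedralPairing lam k n (-l)) / 2 := by
  simp only [dihedralCosPoly, Finset.sum_mul, map_sum, smul_mul_assoc, map_smul, smul_eq_mul,
    evenFunctional_T_mul_T, dihedralPairing, ← Finset.sum_add_distrib, Finset.sum_div]
  exact Finset.sum_congr rfl fun _ _ => by ring

lemma oddFunctional_dihedralSinPoly_mul_U (hlam : 0 < lam) (l : ℤ) :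
    oddFunctional hlam k (dihedralSinPoly lam k n * Polynomial.Chebyshev.U ℝ (l - 1)) =
      (dihedralPairing lam k n l - dihedralPairing lam k n (-l)) / 2 := by
  simp only [dihedralSinPoly, Finset.sum_mul, map_sum, smul_mul_assoc, map_smul, smul_eq_mul,
    oddFunctional_U_mul_U, dihedralPairing, ← Finset.sum_sub_distrib, Finset.sum_div]
  exact Finset.sum_congr rfl fun _ _ => by ring

lemma evenFunctional_dihedralCosPoly_mul_self (hlam : 0 < lam) (hk : 0 < k) :
    evenFunctional hlam k (dihedralCosPoly lam k n * dihedralCosPoly lam k n) =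
      (1 + dihedralDefect lam k n) / 2 * (dihedralCoeffSum lam k n * dihedralMoment lam k 0) := by
  conv_lhs => enter [2, 2]; rw [dihedralCosPoly]
  simp only [Finset.mul_sum, map_sum, mul_smul_comm, map_smul, smul_eq_mul,
    evenFunctional_dihedralCosPoly_mul_T]
  have h1 := sum_dihedralPairing (n := n) hlam hk
  have h2 := sum_dihedralPairing_neg (n := n) hlam hk
  calc _ = ((∑ b ∈ range (n / k + 1), circleCoeff lam (n / k) b *
        dihedralPairing lam k n (n - 2 * k * b)) +
      ∑ b ∈ range (n / k + 1), circleCoeff lam (n / k) b *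
        dihedralPairing lam k n (-(n - 2 * k * b))) / 2 := by
        rw [← Finset.sum_add_distrib, Finset.sum_div]
        exact Finset.sum_congr rfl fun _ _ => by ring
    _ = _ := by rw [h1, h2]; ring

lemma oddFunctional_dihedralSinPoly_mul_self (hlam : 0 < lam) (hk : 0 < k) :
    oddFunctional hlam k (dihedralSinPoly lam k n * dihedralSinPoly lam k n) =
      (1 - dihedralDefect lam k n) / 2 * (dihedralCoeffSum lam k n * dihedralMoment lam k 0) := by
  conv_lhs => enter [2, 2]; rw [dihedralSinPoly]
  simp only [Finset.mul_sum, map_sum, mul_smul_comm, map_smul, smul_eq_mul,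
    oddFunctional_dihedralSinPoly_mul_U]
  have h1 := sum_dihedralPairing (n := n) hlam hk
  have h2 := sum_dihedralPairing_neg (n := n) hlam hk
  calc _ = ((∑ b ∈ range (n / k + 1), circleCoeff lam (n / k) b *
        dihedralPairing lam k n (n - 2 * k * b)) -
      ∑ b ∈ range (n / k + 1), circleCoeff lam (n / k) b *
        dihedralPairing lam k n (-(n - 2 * k * b))) / 2 := by
        rw [← Finset.sum_sub_distrib, Finset.sum_div]
        exact Finset.sum_congr rfl fun _ _ => by ring
    _ = _ := by rw [h1, h2]; ring

end DihedralPolynomials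

section GeneratingFunction

open ComplexConjugate

lemma hasSum_risingBinom_mul_pow (mu : ℝ) {w : ℂ} (hw : ‖w‖ < 1) :
    (Summable fun n : ℕ => ‖(risingBinom mu n : ℂ) * w ^ n‖) ∧
      HasSum (fun n : ℕ => (risingBinom mu n : ℂ) * w ^ n) (1 / (1 - w) ^ (mu : ℂ)) := by
  have h := Complex.one_div_one_sub_cpow_hasFPowerSeriesOnBall_zero mu
  have hmem : w ∈ Metric.eball (0 : ℂ) 1 := by
    simpa [enorm_eq_nnnorm, ← NNReal.coe_lt_one] using hw
  have hc : ∀ n : ℕ, Ring.choose ((mu : ℂ) + n - 1) n = (risingBinom mu n : ℂ) := by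
    intro n
    rw [risingBinom_eq_choose, Complex.ofReal_choose]
    push_cast
    rfl
  have h1 := h.hasSum hmem
  have h2 := FormalMultilinearSeries.summable_norm_apply _
    (Metric.eball_subset_eball h.r_le hmem)
  simp only [FormalMultilinearSeries.ofScalars_apply_eq, smul_eq_mul, hc, zero_add] at h1 h2
  exact ⟨h2, h1⟩

lemma hasSum_sum_risingBinom_mul_pow (mu nu : ℝ) {w : ℂ} (hw : ‖w‖ < 1) :
    (Summable fun m : ℕ => ‖∑ b ∈ range (m + 1),
      ((risingBinom mu (m - b) * risingBinom nu b : ℝ) : ℂ) * (w ^ (m - b) * conj w ^ b)‖) ∧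
    HasSum (fun m : ℕ => ∑ b ∈ range (m + 1),
      ((risingBinom mu (m - b) * risingBinom nu b : ℝ) : ℂ) * (w ^ (m - b) * conj w ^ b))
      (1 / (1 - w) ^ (mu : ℂ) * (1 / (1 - conj w) ^ (nu : ℂ))) := by
  obtain ⟨a1, a2⟩ := hasSum_risingBinom_mul_pow mu hw
  obtain ⟨b1, b2⟩ := hasSum_risingBinom_mul_pow nu (w := conj w) (by simpa using hw)
  have e : ∀ m : ℕ, ∑ b ∈ range (m + 1),
      ((risingBinom mu (m - b) * risingBinom nu b : ℝ) : ℂ) * (w ^ (m - b) * conj w ^ b) =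
      ∑ b ∈ range (m + 1), (risingBinom nu b : ℂ) * conj w ^ b *
        ((risingBinom mu (m - b) : ℂ) * w ^ (m - b)) := by
    intro m
    refine Finset.sum_congr rfl fun b _ => ?_
    push_cast
    ring
  have h1 := summable_norm_sum_mul_range_of_summable_norm b1 a1
  have h2 := hasSum_sum_range_mul_of_summable_norm b1 a1
  rw [b2.tsum_eq, a2.tsum_eq, mul_comm] at h2
  exact ⟨h1.congr fun m => by rw [e], h2.congr_fun e⟩

lemma HasSum.mul_mod_div {k : ℕ} (hk : 0 < k) {a : ℕ → ℂ} {A : ℂ} (ha : HasSum a A)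
    (ha' : Summable fun m => ‖a m‖) (t : ℕ → ℂ) :
    HasSum (fun n => t (n % k) * a (n / k)) ((∑ j ∈ range k, t j) * A) := by
  have : NeZero k := ⟨hk.ne'⟩
  have ht : HasSum (fun j : Fin k => t j) (∑ j ∈ range k, t j) := by
    rw [← Fin.sum_univ_eq_sum_range]; exact hasSum_fintype _
  have hs := summable_mul_of_summable_norm ha' (Summable.of_finite (f := fun j : Fin k => ‖t j‖))
  have h := (Nat.divModEquiv k).hasSum_iff.2 (ha.mul ht hs)
  rw [mul_comm] at h
  refine h.congr_fun fun n => ?_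
  simp [Nat.divModEquiv, mul_comm]

lemma cpow_mul_cpow_conj (lam : ℝ) {w : ℂ} (hw : ‖w‖ < 1) :
    (1 - w) ^ (lam : ℂ) * (1 - conj w) ^ (lam : ℂ) = ((Complex.normSq (1 - w) ^ lam : ℝ) : ℂ) := by
  have hre : 0 < (1 - w).re := by
    have := (Complex.abs_re_le_norm w).trans_lt hw
    have := (abs_lt.1 this).2
    simpa using this
  have harg : (1 - w).arg ≠ π := by
    intro h
    exact absurd (Complex.arg_eq_pi_iff.1 h).1 (by linarith)
  have h1 : (1 - conj w) ^ (lam : ℂ) = conj ((1 - w) ^ (lam : ℂ)) := by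
    rw [← map_one conj, ← map_sub, Complex.conj_cpow _ _ harg, Complex.conj_ofReal, map_one]
  rw [h1, Complex.mul_conj, Complex.normSq_eq_norm_sq, Complex.norm_cpow_real,
    Complex.normSq_eq_norm_sq, ← Real.rpow_natCast, ← Real.rpow_natCast,
    ← Real.rpow_mul (norm_nonneg _), ← Real.rpow_mul (norm_nonneg _), mul_comm]

lemma re_pow_mul_conj_pow (r ψ : ℝ) (a c : ℕ) :
    ((r * Complex.exp (ψ * Complex.I)) ^ a * conj (r * Complex.exp (ψ * Complex.I)) ^ c).re =
      r ^ (a + c) * Real.cos ((a - c) * ψ) := by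
  have e : (r * Complex.exp (ψ * Complex.I)) ^ a * conj (r * Complex.exp (ψ * Complex.I)) ^ c =
      ((r ^ (a + c) : ℝ) : ℂ) * Complex.exp (((a - c) * ψ : ℝ) * Complex.I) := by
    have h : conj (Complex.exp (ψ * Complex.I)) = Complex.exp (-(ψ * Complex.I)) := by
      rw [← Complex.exp_conj]; simp
    rw [map_mul, h, Complex.conj_ofReal, mul_pow, mul_pow, ← Complex.exp_nat_mul,
      ← Complex.exp_nat_mul]
    calc _ = ((r : ℂ) ^ a * r ^ c) * (Complex.exp (a * (ψ * Complex.I)) *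
          Complex.exp (c * -(ψ * Complex.I))) := by ring
      _ = _ := by
        rw [← pow_add, ← Complex.exp_add]
        push_cast
        ring_nf
  rw [e, Complex.re_ofReal_mul, Complex.exp_ofReal_mul_I_re]

lemma normSq_one_sub_pow (r ψ : ℝ) (n : ℕ) :
    Complex.normSq (1 - (r * Complex.exp (ψ * Complex.I)) ^ n) =
      1 - 2 * r ^ n * Real.cos (n * ψ) + r ^ (2 * n) := by
  have h := re_pow_mul_conj_pow r ψ n 0
  have h2 : Complex.normSq ((r * Complex.exp (ψ * Complex.I)) ^ n) = r ^ (2 * n) := by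
    rw [Complex.normSq_eq_norm_sq, norm_pow, norm_mul, Complex.norm_exp_ofReal_mul_I, mul_one,
      Complex.norm_real, Real.norm_eq_abs, ← pow_mul, mul_comm, pow_mul, sq_abs, ← pow_mul]
  simp only [pow_zero, mul_one, add_zero, Nat.cast_zero, sub_zero] at h
  rw [Complex.normSq_sub, h2, map_one, one_mul, Complex.conj_re, h]
  ring

/-- Comparison of the generating coefficients with parameters `(λ, λ)` and `(λ + 1, λ)`. -/
lemma sum_risingBinom_mul_cos (lam : ℝ) (m : ℕ) (x : ℝ) :
    (2 * lam + m) * ∑ b ∈ range (m + 1),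
        risingBinom lam (m - b) * risingBinom lam b * Real.cos ((m - 2 * b) * x) =
      2 * lam * ∑ b ∈ range (m + 1), circleCoeff lam m b * Real.cos ((m - 2 * b) * x) := by
  have h1 : lam * ∑ b ∈ range (m + 1), circleCoeff lam m b * Real.cos ((m - 2 * b) * x) =
      ∑ b ∈ range (m + 1), (lam + m - b) *
        (risingBinom lam (m - b) * risingBinom lam b * Real.cos ((m - 2 * b) * x)) := by
    rw [Finset.mul_sum]
    refine Finset.sum_congr rfl fun b hb => ?_
    have hb' : b ≤ m := by have := mem_range.1 hb; omega
    have := risingBinom_add_one lam (m - b)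
    push_cast [Nat.cast_sub hb'] at this
    rw [circleCoeff]
    linear_combination risingBinom lam b * Real.cos ((m - 2 * b) * x) * this
  have h2 : ∑ b ∈ range (m + 1), (lam + m - b) *
        (risingBinom lam (m - b) * risingBinom lam b * Real.cos ((m - 2 * b) * x)) =
      ∑ b ∈ range (m + 1), (lam + b) *
        (risingBinom lam (m - b) * risingBinom lam b * Real.cos ((m - 2 * b) * x)) := by
    rw [← Finset.sum_range_reflect]
    refine Finset.sum_congr rfl fun b hb => ?_
    have hb' : b ≤ m := by have := mem_range.1 hb; omega
    have e1 : m + 1 - 1 - b = m - b := by omega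
    have e2 : m - (m - b) = b := by omega
    rw [e1, e2, Nat.cast_sub hb', show ((m : ℝ) - 2 * (m - b)) * x = -((m - 2 * b) * x) by ring,
      Real.cos_neg]
    ring
  have h3 : 2 * lam * ∑ b ∈ range (m + 1), circleCoeff lam m b * Real.cos ((m - 2 * b) * x) =
      ∑ b ∈ range (m + 1), (lam + m - b) *
        (risingBinom lam (m - b) * risingBinom lam b * Real.cos ((m - 2 * b) * x)) +
      ∑ b ∈ range (m + 1), (lam + b) *
        (risingBinom lam (m - b) * risingBinom lam b * Real.cos ((m - 2 * b) * x)) := by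
    rw [← h2, ← h1]; ring
  rw [h3, ← Finset.sum_add_distrib, Finset.mul_sum]
  exact Finset.sum_congr rfl fun b _ => by ring

lemma hasSum_dihedralCosPoly {lam : ℝ} (hlam : 0 < lam) {k : ℕ} (hk : 0 < k) {r : ℝ}
    (hr0 : 0 ≤ r) (hr1 : r < 1) (ψ : ℝ) :
    HasSum (fun n : ℕ => 2 / (1 + dihedralDefect lam k n) *
        (dihedralCosPoly lam k n).eval (Real.cos ψ) * r ^ n)
      ((1 - r ^ 2) / ((1 - 2 * r * Real.cos ψ + r ^ 2) *
        (1 - 2 * r ^ k * Real.cos (k * ψ) + r ^ (2 * k)) ^ lam)) := by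
  set z : ℂ := r * Complex.exp (ψ * Complex.I) with hz
  have hznorm : ‖z‖ < 1 := by
    rw [hz, norm_mul, Complex.norm_exp_ofReal_mul_I, mul_one, Complex.norm_real,
      Real.norm_eq_abs, abs_of_nonneg hr0]
    exact hr1
  have hz1 : 1 - z ≠ 0 := by
    intro h
    rw [← sub_eq_zero.1 h, norm_one] at hznorm
    exact lt_irrefl _ hznorm
  have hw : ‖z ^ k‖ < 1 := by
    rw [norm_pow]; exact pow_lt_one₀ (norm_nonneg _) hznorm hk.ne'
  have hw1 : 1 - z ^ k ≠ 0 := by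
    intro h
    rw [← sub_eq_zero.1 h, norm_one] at hw
    exact lt_irrefl _ hw
  set N := Complex.normSq (1 - z ^ k) ^ lam with hN
  have hcpow := cpow_mul_cpow_conj lam hw
  obtain ⟨f1, f2⟩ := hasSum_sum_risingBinom_mul_pow (lam + 1) lam hw
  obtain ⟨g1, g2⟩ := hasSum_sum_risingBinom_mul_pow lam lam hw
  have hG : 1 / (1 - z ^ k) ^ (lam : ℂ) * (1 / (1 - conj (z ^ k)) ^ (lam : ℂ)) =
      ((N⁻¹ : ℝ) : ℂ) := by
    rw [div_mul_div_comm, hcpow, one_mul]; push_cast; rw [one_div]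
  have hF : 1 / (1 - z ^ k) ^ ((lam + 1 : ℝ) : ℂ) * (1 / (1 - conj (z ^ k)) ^ (lam : ℂ)) =
      ((N⁻¹ : ℝ) : ℂ) / (1 - z ^ k) := by
    rw [← hG]; push_cast; rw [Complex.cpow_add _ _ hw1, Complex.cpow_one]
    field_simp
  rw [hF] at f2
  rw [hG] at g2
  have F := f2.mul_mod_div hk f1 (fun j => z ^ j)
  have G := g2.mul_mod_div hk g1 (fun j => if j = 0 then 1 else 0)
  have hsum : (∑ j ∈ range k, z ^ j) * (((N⁻¹ : ℝ) : ℂ) / (1 - z ^ k)) =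
      ((N⁻¹ : ℝ) : ℂ) * (1 - z)⁻¹ := by
    have := mul_neg_geom_sum z k
    rw [← this]
    rw [← this] at hw1
    have h3 := right_ne_zero_of_mul hw1
    field_simp
  rw [hsum] at F
  rw [Finset.sum_ite_eq' (range k) 0 (fun _ => (1 : ℂ)), if_pos (by simpa using hk), one_mul] at G
  have F' := Complex.hasSum_re F
  have G' := Complex.hasSum_re G
  rw [Complex.ofReal_re] at G'
  rw [Complex.re_ofReal_mul, Complex.inv_re] at F'
  have key := (F'.mul_left 2).sub G'
  have hval : 2 * (N⁻¹ * ((1 - z).re / Complex.normSq (1 - z))) - N⁻¹ =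
      (1 - r ^ 2) / ((1 - 2 * r * Real.cos ψ + r ^ 2) *
        (1 - 2 * r ^ k * Real.cos (k * ψ) + r ^ (2 * k)) ^ lam) := by
    have n1 := normSq_one_sub_pow r ψ 1
    have n2 := normSq_one_sub_pow r ψ k
    have hre : (1 - z).re = 1 - r * Real.cos ψ := by
      rw [Complex.sub_re, Complex.one_re, hz, Complex.re_ofReal_mul, Complex.exp_ofReal_mul_I_re]
    rw [← hz] at n1 n2
    simp only [pow_one, Nat.cast_one, one_mul, mul_one] at n1
    have hpos : 0 < Complex.normSq (1 - z) := Complex.normSq_pos.2 hz1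
    have hNpos : 0 < N := Real.rpow_pos_of_pos (Complex.normSq_pos.2 hw1) _
    rw [← n2, ← hN, hre, ← n1]
    field_simp
    rw [n1]
    ring
  rw [hval] at key
  refine key.congr_fun fun n => ?_
  have hterm : ∀ b ∈ range (n / k + 1), ∀ x : ℝ,
      (z ^ (n % k) * ((x : ℂ) * ((z ^ k) ^ (n / k - b) * conj (z ^ k) ^ b))).re =
        x * Real.cos ((n - 2 * k * b) * ψ) * r ^ n := by
    intro b hb x
    have hb' : b ≤ n / k := by have := mem_range.1 hb; omega
    have hmod := Nat.mod_add_div n k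
    have h1 := re_pow_mul_conj_pow r ψ (n % k + k * (n / k - b)) (k * b)
    have e1 : n % k + k * (n / k - b) + k * b = n := by
      rw [add_assoc, ← mul_add, Nat.sub_add_cancel hb', hmod]
    have e2 : ((n % k + k * (n / k - b) : ℕ) : ℝ) = n - k * b := by
      rw [eq_sub_iff_add_eq]; exact_mod_cast e1
    rw [e1, e2, ← hz] at h1
    have e3 : z ^ (n % k) * ((x : ℂ) * ((z ^ k) ^ (n / k - b) * conj (z ^ k) ^ b)) =
        x * (z ^ (n % k + k * (n / k - b)) * conj z ^ (k * b)) := by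
      rw [map_pow, ← pow_mul, ← pow_mul, pow_add]; ring
    rw [e3, Complex.re_ofReal_mul, h1]
    push_cast
    ring_nf
  have hFre : (z ^ (n % k) * ∑ b ∈ range (n / k + 1),
      ((risingBinom (lam + 1) (n / k - b) * risingBinom lam b : ℝ) : ℂ) *
        ((z ^ k) ^ (n / k - b) * conj (z ^ k) ^ b)).re =
      (dihedralCosPoly lam k n).eval (Real.cos ψ) * r ^ n := by
    rw [eval_dihedralCosPoly, Finset.mul_sum, Complex.re_sum, Finset.sum_mul]
    exact Finset.sum_congr rfl fun b hb => hterm b hb _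
  rw [hFre, dihedralDefect]
  split_ifs with hd hd' hd'
  · have h0 : z ^ (n % k) = 1 := by rw [hd', pow_zero]
    rw [← h0, Finset.mul_sum, Complex.re_sum, Finset.sum_congr rfl fun b hb => hterm b hb _,
      eval_dihedralCosPoly]
    obtain ⟨m, rfl⟩ := hd
    rw [Nat.mul_div_cancel_left m hk]
    have hs := sum_risingBinom_mul_cos lam m (k * ψ)
    have e : ∀ b : ℕ, (((k * m : ℕ) : ℝ) - 2 * k * b) * ψ = (m - 2 * b) * (k * ψ) := by
      intro b; push_cast; ring
    simp only [e, ← Finset.sum_mul]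
    have hne : lam + m ≠ 0 := by positivity
    have hne2 : 2 * lam + m ≠ 0 := by positivity
    rw [eq_div_of_mul_eq hne2 ((mul_comm _ _).trans hs),
      show 1 + lam / (lam + m) = (2 * lam + m) / (lam + m) by field_simp; ring]
    generalize ∑ b ∈ range (m + 1), circleCoeff lam m b * Real.cos ((m - 2 * b) * (k * ψ)) = S
    field_simp
    ring
  · exact absurd (Nat.mod_eq_zero_of_dvd hd) hd'
  · exact absurd (Nat.dvd_of_mod_eq_zero hd') hd
  · simp
    ring

end GeneratingFunction

section Bounds

variable {lam : ℝ} {k n : ℕ}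

lemma abs_eval_U_natCast_le (n : ℕ) {x : ℝ} (hx : |x| ≤ 1) :
    |(Polynomial.Chebyshev.U ℝ n).eval x| ≤ n + 1 := by
  induction n with
  | zero => simp
  | succ n ih =>
    have h := congrArg (Polynomial.eval x) (Polynomial.Chebyshev.U_eq_X_mul_U_add_T ℝ n)
    rw [Polynomial.eval_add, Polynomial.eval_mul, Polynomial.eval_X] at h
    have hT := Polynomial.Chebyshev.abs_eval_T_real_le_one (n + 1) hx
    push_cast
    rw [h]
    refine (abs_add_le _ _).trans (add_le_add ?_ hT)
    rw [abs_mul]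
    exact (mul_le_of_le_one_left (abs_nonneg _) hx).trans ih

lemma abs_eval_U_sub_one_le (l : ℤ) {x : ℝ} (hx : |x| ≤ 1) :
    |(Polynomial.Chebyshev.U ℝ (l - 1)).eval x| ≤ l.natAbs := by
  have key : ∀ n : ℕ, |(Polynomial.Chebyshev.U ℝ ((n : ℤ) - 1)).eval x| ≤ n := by
    rintro (_ | n)
    · simp
    · simpa using abs_eval_U_natCast_le n hx
  obtain ⟨n, rfl | rfl⟩ := l.eq_nat_or_neg
  · simpa using key n
  · rw [Polynomial.Chebyshev.U_neg_sub_one, Polynomial.eval_neg, abs_neg]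
    simpa using key n

lemma abs_eval_dihedralCosPoly_le (hlam : 0 < lam) (k n : ℕ) {x : ℝ} (hx : |x| ≤ 1) :
    |(dihedralCosPoly lam k n).eval x| ≤ dihedralCoeffSum lam k n := by
  rw [dihedralCosPoly, Polynomial.eval_finsetSum]
  refine (Finset.abs_sum_le_sum_abs _ _).trans (Finset.sum_le_sum fun b _ => ?_)
  have hc := (circleCoeff_pos hlam (n / k) b).le
  rw [Polynomial.eval_smul, smul_eq_mul, abs_mul, abs_of_nonneg hc]
  exact mul_le_of_le_one_right hc (Polynomial.Chebyshev.abs_eval_T_real_le_one _ hx)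

lemma abs_eval_dihedralSinPoly_le (hlam : 0 < lam) (k n : ℕ) {x : ℝ} (hx : |x| ≤ 1) :
    |(dihedralSinPoly lam k n).eval x| ≤ n * dihedralCoeffSum lam k n := by
  rw [dihedralSinPoly, Polynomial.eval_finsetSum, dihedralCoeffSum, Finset.mul_sum]
  refine (Finset.abs_sum_le_sum_abs _ _).trans (Finset.sum_le_sum fun b hb => ?_)
  have hc := (circleCoeff_pos hlam (n / k) b).le
  rw [Polynomial.eval_smul, smul_eq_mul, abs_mul, abs_of_nonneg hc, mul_comm]
  refine mul_le_mul_of_nonneg_right ((abs_eval_U_sub_one_le _ hx).trans ?_) hc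
  exact_mod_cast natAbs_sub_le n hb

lemma dihedralDefect_le_one (hlam : 0 < lam) (k n : ℕ) : dihedralDefect lam k n ≤ 1 := by
  unfold dihedralDefect
  split_ifs
  · rw [div_le_one (by positivity)]
    simp
  · exact zero_le_one

lemma inv_le_one_sub_dihedralDefect (hlam : 0 < lam) (hk : 0 < k) (hn : 0 < n) :
    (lam + 1)⁻¹ ≤ 1 - dihedralDefect lam k n := by
  unfold dihedralDefect
  split_ifs with hd
  · have hm : (1 : ℝ) ≤ (n / k : ℕ) := by
      exact_mod_cast Nat.div_pos (Nat.le_of_dvd hn hd) hk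
    have e : 1 - lam / (lam + (n / k : ℕ)) = (n / k : ℕ) / (lam + (n / k : ℕ)) := by
      field_simp; ring
    rw [e, inv_eq_one_div, div_le_div_iff₀ (by positivity) (by positivity)]
    nlinarith
  · rw [sub_zero]
    exact inv_le_one_of_one_le₀ (by linarith)

lemma eval_dihedralCosPoly_one (lam : ℝ) (k n : ℕ) :
    (dihedralCosPoly lam k n).eval 1 = dihedralCoeffSum lam k n := by
  have := eval_dihedralCosPoly (lam := lam) (k := k) n 0
  simpa [dihedralCoeffSum] using this

lemma summable_dihedralCoeffSum_mul_pow (hlam : 0 < lam) (hk : 0 < k) {r : ℝ} (hr0 : 0 ≤ r)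
    (hr1 : r < 1) : Summable fun n : ℕ => dihedralCoeffSum lam k n * r ^ n := by
  refine (hasSum_dihedralCosPoly hlam hk hr0 hr1 0).summable.of_nonneg_of_le
    (fun n => mul_nonneg (dihedralCoeffSum_pos n hlam).le (pow_nonneg hr0 n)) fun n => ?_
  refine mul_le_mul_of_nonneg_right ?_ (pow_nonneg hr0 n)
  rw [Real.cos_zero, eval_dihedralCosPoly_one]
  refine le_mul_of_one_le_left (dihedralCoeffSum_pos n hlam).le ?_
  have h0 := dihedralDefect_nonneg (lam := lam) (k := k) n hlam
  have h1 := dihedralDefect_le_one hlam k n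
  rw [le_div_iff₀ (by positivity)]
  linarith

lemma summable_sq_mul_dihedralCoeffSum_mul_pow (hlam : 0 < lam) (hk : 0 < k) {r : ℝ}
    (hr0 : 0 ≤ r) (hr1 : r < 1) :
    Summable fun n : ℕ => (n : ℝ) ^ 2 * dihedralCoeffSum lam k n * r ^ n := by
  have h := isLittleO_pow_const_mul_const_pow_const_pow_of_norm_lt (R := ℝ) 2 (r₁ := r)
    (r₂ := (1 + r) / 2) (by rw [Real.norm_eq_abs, abs_of_nonneg hr0]; linarith)
  refine summable_of_isBigO_nat (summable_dihedralCoeffSum_mul_pow hlam hk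
    (r := (1 + r) / 2) (by linarith) (by linarith)) ?_
  refine ((Asymptotics.isBigO_refl (fun n => dihedralCoeffSum lam k n) _).mul h.isBigO).congr_left
    fun n => by ring

end Bounds

section Kernels

variable {lam : ℝ} {k : ℕ}

lemma hnorm_wminus (hlam : 0 < lam) (f : ℝ[X]) :
    hnorm (wminus lam k) f = evenFunctional hlam k (f * f) / dihedralMoment lam k 0 := by
  have h1 := integral_mul_wminus lam k fun t => (f.eval t) ^ 2
  have h2 := integral_mul_wminus lam k fun _ => 1
  simp only [one_mul] at h2
  rw [hnorm, h1, h2, evenFunctional, cosFunctional_apply, dihedralMoment]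
  simp [sq]

lemma hnorm_wplus (hlam : 0 < lam) (hk : 2 ≤ k) (f : ℝ[X]) :
    hnorm (wplus lam k) f = oddFunctional hlam k (f * f) / (dihedralMoment lam k 0 / 2) := by
  have h1 := integral_mul_wplus lam k fun t => (f.eval t) ^ 2
  have h2 := integral_mul_wplus lam k fun _ => 1
  have h3 := oddFunctional_U_mul_U (k := k) hlam 1 1
  have h4 : dihedralMoment lam k (1 - -1) = 0 := by
    refine dihedralMoment_of_not_dvd hlam (by omega) fun h => ?_
    have := Int.le_of_dvd (by norm_num) h
    omega
  rw [h4, oddFunctional, cosFunctional_apply] at h3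
  simp only [one_mul] at h2
  simp only [sub_self, Polynomial.Chebyshev.U_zero, mul_one, Polynomial.eval_one, one_mul,
    sub_zero] at h3
  rw [hnorm, h1, h2, h3, oddFunctional, cosFunctional_apply]
  simp [sq]

lemma pi_div_natCast_le_pi (k : ℕ) : π / k ≤ π := by
  rcases Nat.eq_zero_or_pos k with rfl | hk
  · simpa using Real.pi_pos.le
  · exact div_le_self Real.pi_pos.le (by exact_mod_cast hk)

lemma dihedralWeight_pos (lam : ℝ) (hk : 0 < k) {θ : ℝ} (hθ : θ ∈ Set.Ioo 0 (π / k)) :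
    0 < dihedralWeight lam k θ := by
  have hk' : (0 : ℝ) < k := by exact_mod_cast hk
  have h1 : 0 < (k : ℝ) * θ := mul_pos hk' hθ.1
  have h2 : (k : ℝ) * θ < π := by
    have := hθ.2
    rwa [lt_div_iff₀ hk', mul_comm] at this
  exact Real.rpow_pos_of_pos (abs_pos.2 (Real.sin_pos_of_pos_of_lt_pi h1 h2).ne') _

lemma evenFunctional_mul_self_pos (hlam : 0 < lam) (hk : 0 < k) {f : ℝ[X]} (hf : f ≠ 0) :
    0 < evenFunctional hlam k (f * f) :=
  cosFunctional_mul_self_pos _ (dihedralWeight_nonneg lam k) (by positivity)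
    (pi_div_natCast_le_pi k) (fun _ hθ => dihedralWeight_pos lam hk hθ) hf

lemma oddFunctional_mul_self_pos (hlam : 0 < lam) (hk : 0 < k) {f : ℝ[X]} (hf : f ≠ 0) :
    0 < oddFunctional hlam k (f * f) := by
  refine cosFunctional_mul_self_pos _
    (fun θ => mul_nonneg (sq_nonneg _) (dihedralWeight_nonneg lam k θ)) (by positivity)
    (pi_div_natCast_le_pi k) (fun θ hθ => mul_pos ?_ (dihedralWeight_pos lam hk hθ)) hf
  exact pow_pos (Real.sin_pos_of_pos_of_lt_pi hθ.1 (hθ.2.trans_le (pi_div_natCast_le_pi k))) 2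

/-- The reproducing kernel of `w⁻` in degree `n`, in terms of the explicit polynomials. -/
lemma IsOPS.wminus_kernel (hlam : 0 < lam) (hk : 0 < k) {q : ℕ → ℝ[X]}
    (hq : IsOPS (wminus lam k) q) (n : ℕ) (x y : ℝ) :
    (q n).eval x * (q n).eval y / hnorm (wminus lam k) (q n) =
      2 / (1 + dihedralDefect lam k n) * ((dihedralCosPoly lam k n).eval x *
        (dihedralCosPoly lam k n).eval y / dihedralCoeffSum lam k n) := by
  have hM := dihedralMoment_zero_pos hlam hk
  have hY := dihedralCoeffSum_pos (k := k) n hlam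
  have hδ := dihedralDefect_nonneg (k := k) n hlam
  have hself := evenFunctional_dihedralCosPoly_mul_self (n := n) hlam hk
  have h := eval_mul_eval_div_eq_of_orthogonal (B := evenFunctional hlam k)
    (fun f hf => evenFunctional_mul_self_pos hlam hk hf) hq.1
    (fun a b hab => by
      rw [evenFunctional, cosFunctional_apply]
      simp only [Polynomial.eval_mul]
      exact (integral_mul_wminus lam k fun t => (q a).eval t * (q b).eval t).symm.trans
        (hq.2 a b hab))
    (T := fun l => Polynomial.Chebyshev.T ℝ l)
    (fun l => by simp)
    (degree_dihedralCosPoly_le (lam := lam) (k := k) n)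
    (fun l hl => by
      rw [evenFunctional_dihedralCosPoly_mul_T, dihedralPairing_eq_zero hlam hk (by omega)
        (by omega), dihedralPairing_eq_zero hlam hk (by omega) (by omega)]
      simp)
    (by rw [hself]; positivity) x y
  rw [hnorm_wminus hlam, div_div_eq_mul_div, mul_div_right_comm, h, hself]
  field_simp

/-- The reproducing kernel of `w⁺` in degree `n`, in terms of the explicit polynomials. -/
lemma IsOPS.wplus_kernel (hlam : 0 < lam) (hk : 2 ≤ k) {s : ℕ → ℝ[X]}
    (hs : IsOPS (wplus lam k) s) (n : ℕ) (x y : ℝ) :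
    (s n).eval x * (s n).eval y / hnorm (wplus lam k) (s n) =
      (1 - dihedralDefect lam k (n + 1))⁻¹ * ((dihedralSinPoly lam k (n + 1)).eval x *
        (dihedralSinPoly lam k (n + 1)).eval y / dihedralCoeffSum lam k (n + 1)) := by
  have hk0 : 0 < k := by omega
  have hM := dihedralMoment_zero_pos hlam hk0
  have hY := dihedralCoeffSum_pos (k := k) (n + 1) hlam
  have hδ : 0 < 1 - dihedralDefect lam k (n + 1) :=
    (by positivity : 0 < (lam + 1)⁻¹).trans_le (inv_le_one_sub_dihedralDefect hlam hk0 n.succ_pos)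
  have hself := oddFunctional_dihedralSinPoly_mul_self (n := n + 1) hlam hk0
  have h := eval_mul_eval_div_eq_of_orthogonal (B := oddFunctional hlam k)
    (fun f hf => oddFunctional_mul_self_pos hlam hk0 hf) hs.1
    (fun a b hab => by
      rw [oddFunctional, cosFunctional_apply]
      simp only [Polynomial.eval_mul]
      exact (integral_mul_wplus lam k fun t => (s a).eval t * (s b).eval t).symm.trans
        (hs.2 a b hab))
    (T := fun l => Polynomial.Chebyshev.U ℝ l)
    (fun l => Polynomial.Chebyshev.degree_U_natCast ℝ l)
    (degree_dihedralSinPoly_le (lam := lam) (k := k) n)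
    (fun l hl => by
      have := oddFunctional_dihedralSinPoly_mul_U (n := n + 1) (k := k) hlam (l + 1)
      rw [add_sub_cancel_right] at this
      rw [this, dihedralPairing_eq_zero hlam hk0 (by omega)
        (by omega), dihedralPairing_eq_zero hlam hk0 (by omega) (by omega)]
      simp)
    (by rw [hself]; positivity) x y
  rw [hnorm_wplus hlam hk, div_div_eq_mul_div, mul_div_right_comm, h, hself]
  field_simp

lemma eval_dihedralCosPoly_vertex (lam : ℝ) (hk : 0 < k) (n p : ℕ) :
    (dihedralCosPoly lam k n).eval (Real.cos (p * π / k)) =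
      Real.cos (n * (p * π / k)) * dihedralCoeffSum lam k n := by
  rw [eval_dihedralCosPoly, dihedralCoeffSum, Finset.mul_sum]
  refine Finset.sum_congr rfl fun b _ => ?_
  have e : ((n : ℝ) - 2 * k * b) * (p * π / k) =
      n * (p * π / k) - (p * b : ℕ) * (2 * π) := by push_cast; field_simp
  rw [e, Real.cos_sub_nat_mul_two_pi, mul_comm]

lemma eval_dihedralSinPoly_vertex (lam : ℝ) (hk : 0 < k) (n p : ℕ) :
    (dihedralSinPoly lam k n).eval (Real.cos (p * π / k)) * Real.sin (p * π / k) =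
      Real.sin (n * (p * π / k)) * dihedralCoeffSum lam k n := by
  rw [eval_dihedralSinPoly_mul_sin, dihedralCoeffSum, Finset.mul_sum]
  refine Finset.sum_congr rfl fun b _ => ?_
  have e : ((n : ℝ) - 2 * k * b) * (p * π / k) =
      n * (p * π / k) - (p * b : ℕ) * (2 * π) := by push_cast; field_simp
  rw [e, Real.sin_sub_nat_mul_two_pi, mul_comm]

/-- Addition formula: translation of the even `h`-harmonic by a vertex angle. -/
lemma eval_dihedralCosPoly_sub_vertex (lam : ℝ) (hk : 0 < k) (n p : ℕ) (θ : ℝ) :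
    (dihedralCosPoly lam k n).eval (Real.cos (θ - p * π / k)) =
      Real.cos (n * (p * π / k)) * (dihedralCosPoly lam k n).eval (Real.cos θ) +
      Real.sin (n * (p * π / k)) *
        ((dihedralSinPoly lam k n).eval (Real.cos θ) * Real.sin θ) := by
  rw [eval_dihedralCosPoly, eval_dihedralCosPoly, eval_dihedralSinPoly_mul_sin, Finset.mul_sum,
    Finset.mul_sum, ← Finset.sum_add_distrib]
  refine Finset.sum_congr rfl fun b _ => ?_
  have e : ((n : ℝ) - 2 * k * b) * (θ - p * π / k) =
      (n - 2 * k * b) * θ - n * (p * π / k) + (p * b : ℕ) * (2 * π) := by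
    push_cast; field_simp; ring
  rw [e, Real.cos_add_nat_mul_two_pi, Real.cos_sub]
  ring

lemma wplus_kernel_coeff (hk : 0 < k) (n p : ℕ) :
    (1 - dihedralDefect lam k n)⁻¹ * Real.sin (n * (p * π / k)) =
      (1 + dihedralDefect lam k n)⁻¹ * Real.sin (n * (p * π / k)) := by
  rw [dihedralDefect]
  split_ifs with hd
  · obtain ⟨m, rfl⟩ := hd
    have e : ((k * m : ℕ) : ℝ) * (p * π / k) = (m * p : ℕ) * π := by push_cast; field_simp
    rw [e, Real.sin_nat_mul_pi, mul_zero, mul_zero]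
  · simp

lemma summable_abs_wminus_kernel (hlam : 0 < lam) (hk : 0 < k) {q : ℕ → ℝ[X]}
    (hq : IsOPS (wminus lam k) q) {r : ℝ} (hr0 : 0 ≤ r) (hr1 : r < 1) {x y : ℝ}
    (hx : |x| ≤ 1) (hy : |y| ≤ 1) :
    Summable fun n : ℕ =>
      |(q n).eval x * (q n).eval y / hnorm (wminus lam k) (q n) * r ^ n| := by
  refine ((summable_dihedralCoeffSum_mul_pow hlam hk hr0 hr1).mul_left 2).of_nonneg_of_le
    (fun n => abs_nonneg _) fun n => ?_
  have hY := dihedralCoeffSum_pos (k := k) n hlam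
  have hδ := dihedralDefect_nonneg (k := k) n hlam
  have hκ : 0 ≤ 2 / (1 + dihedralDefect lam k n) := by positivity
  rw [hq.wminus_kernel hlam hk, abs_mul, abs_mul, abs_of_nonneg hκ, abs_div, abs_mul,
    abs_of_nonneg (pow_nonneg hr0 n), abs_of_nonneg hY.le, ← mul_assoc]
  refine mul_le_mul_of_nonneg_right ?_ (pow_nonneg hr0 n)
  refine mul_le_mul (div_le_self zero_le_two (by linarith)) ?_ (by positivity) zero_le_two
  rw [div_le_iff₀ hY]
  exact mul_le_mul (abs_eval_dihedralCosPoly_le hlam k n hx)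
    (abs_eval_dihedralCosPoly_le hlam k n hy) (abs_nonneg _) hY.le

lemma summable_abs_wplus_kernel (hlam : 0 < lam) (hk : 2 ≤ k) {s : ℕ → ℝ[X]}
    (hs : IsOPS (wplus lam k) s) {r : ℝ} (hr0 : 0 ≤ r) (hr1 : r < 1) {x y : ℝ}
    (hx : |x| ≤ 1) (hy : |y| ≤ 1) :
    Summable fun n : ℕ =>
      |(s n).eval x * (s n).eval y / hnorm (wplus lam k) (s n) * r ^ (n + 1)| := by
  have hk0 : 0 < k := by omega
  refine (((summable_nat_add_iff 1).2 (summable_sq_mul_dihedralCoeffSum_mul_pow hlam hk0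
    hr0 hr1)).mul_left (lam + 1)).of_nonneg_of_le (fun n => abs_nonneg _) fun n => ?_
  have hY := dihedralCoeffSum_pos (k := k) (n + 1) hlam
  have hδ' := inv_le_one_sub_dihedralDefect (n := n + 1) hlam hk0 n.succ_pos
  have hδ : 0 < 1 - dihedralDefect lam k (n + 1) :=
    (by positivity : 0 < (lam + 1)⁻¹).trans_le hδ'
  rw [hs.wplus_kernel hlam hk, abs_mul, abs_mul, abs_div, abs_mul,
    abs_of_nonneg (pow_nonneg hr0 (n + 1)), abs_of_nonneg hY.le,
    abs_of_nonneg (inv_nonneg.2 hδ.le), ← mul_assoc]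
  refine mul_le_mul_of_nonneg_right ?_ (pow_nonneg hr0 (n + 1))
  refine mul_le_mul (inv_le_of_inv_le₀ (by positivity) hδ') ?_ (by positivity) (by positivity)
  rw [div_le_iff₀ hY]
  calc _ ≤ ((n + 1 : ℕ) * dihedralCoeffSum lam k (n + 1)) *
        ((n + 1 : ℕ) * dihedralCoeffSum lam k (n + 1)) :=
        mul_le_mul (abs_eval_dihedralSinPoly_le hlam k (n + 1) hx)
          (abs_eval_dihedralSinPoly_le hlam k (n + 1) hy) (abs_nonneg _) (by positivity)
    _ = _ := by ring

end Kernels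

/-- closed formula for the Poisson kernel of the `h`-harmonics of the
dihedral group `I_k`, with one argument at a vertex `(cos(pπ/k), sin(pπ/k))`. -/
theorem poisson_kernel_dihedral (lam : ℝ) (hlam : 0 < lam) (k : ℕ) (hk : 2 ≤ k)
    (p : ℕ) (hp : p ≤ k - 1) (q s : ℕ → Polynomial ℝ)
    (hq : IsOPS (wminus lam k) q) (hs : IsOPS (wplus lam k) s)
    (θ r : ℝ) (hr0 : 0 ≤ r) (hr1 : r < 1) :
    Summable (fun n : ℕ =>
      |(q n).eval (Real.cos θ) * (q n).eval (Real.cos (p * π / k)) /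
        hnorm (wminus lam k) (q n) * r ^ n|) ∧
    Summable (fun n : ℕ =>
      |(s n).eval (Real.cos θ) * (s n).eval (Real.cos (p * π / k)) /
        hnorm (wplus lam k) (s n) * r ^ (n + 1)|) ∧
    (∑' n : ℕ, (q n).eval (Real.cos θ) * (q n).eval (Real.cos (p * π / k)) /
        hnorm (wminus lam k) (q n) * r ^ n) +
      2 * Real.sin θ * Real.sin (p * π / k) *
        (∑' n : ℕ, (s n).eval (Real.cos θ) * (s n).eval (Real.cos (p * π / k)) /
          hnorm (wplus lam k) (s n) * r ^ (n + 1)) =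
      (1 - r ^ 2) /
        ((1 - 2 * r * Real.cos (θ - p * π / k) + r ^ 2) *
          (1 - 2 * (-1 : ℝ) ^ p * r ^ k * Real.cos (k * θ) + r ^ (2 * k)) ^ lam) := by
  have hk0 : 0 < k := by omega
  set φ := p * π / k with hφ
  have hq' := summable_abs_wminus_kernel hlam hk0 hq hr0 hr1 (Real.abs_cos_le_one θ)
    (Real.abs_cos_le_one φ)
  have hs' := summable_abs_wplus_kernel hlam hk hs hr0 hr1 (Real.abs_cos_le_one θ)
    (Real.abs_cos_le_one φ)
  refine ⟨hq', hs', ?_⟩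
  have h := (hasSum_dihedralCosPoly hlam hk0 hr0 hr1 (θ - φ)).tsum_eq
  have hcos : Real.cos (k * (θ - φ)) = (-1) ^ p * Real.cos (k * θ) := by
    have e : k * (θ - φ) = k * θ - p * π := by rw [hφ]; field_simp
    rw [e, Real.cos_sub_nat_mul_pi]
  rw [hcos, show 2 * r ^ k * ((-1) ^ p * Real.cos (k * θ)) =
    2 * (-1) ^ p * r ^ k * Real.cos (k * θ) by ring] at h
  rw [← h, ← tsum_mul_left]
  have hodd : ∀ n : ℕ, 2 * Real.sin θ * Real.sin φ *
      ((s n).eval (Real.cos θ) * (s n).eval (Real.cos φ) /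
        hnorm (wplus lam k) (s n) * r ^ (n + 1)) =
      2 / (1 + dihedralDefect lam k (n + 1)) * (Real.sin ((n + 1 : ℕ) * φ) *
        ((dihedralSinPoly lam k (n + 1)).eval (Real.cos θ) * Real.sin θ)) * r ^ (n + 1) := by
    intro n
    have hY := (dihedralCoeffSum_pos (k := k) (n + 1) hlam).ne'
    have hv := eval_dihedralSinPoly_vertex lam hk0 (n + 1) p
    have hc := wplus_kernel_coeff (lam := lam) hk0 (n + 1) p
    rw [← hφ] at hv hc
    rw [hs.wplus_kernel hlam hk]
    calc _ = 2 * (1 - dihedralDefect lam k (n + 1))⁻¹ *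
          ((dihedralSinPoly lam k (n + 1)).eval (Real.cos φ) * Real.sin φ /
            dihedralCoeffSum lam k (n + 1)) *
          ((dihedralSinPoly lam k (n + 1)).eval (Real.cos θ) * Real.sin θ) * r ^ (n + 1) := by ring
      _ = 2 * ((1 - dihedralDefect lam k (n + 1))⁻¹ * Real.sin ((n + 1 : ℕ) * φ)) *
          ((dihedralSinPoly lam k (n + 1)).eval (Real.cos θ) * Real.sin θ) * r ^ (n + 1) := by
        rw [hv, mul_div_cancel_right₀ _ hY]; ring
      _ = _ := by rw [hc]; ring
  have hsum := (hs'.of_abs.mul_left (2 * Real.sin θ * Real.sin φ))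
  simp only [hodd] at hsum ⊢
  have hsum0 := (summable_nat_add_iff (f := fun n : ℕ => 2 / (1 + dihedralDefect lam k n) *
    (Real.sin (n * φ) * ((dihedralSinPoly lam k n).eval (Real.cos θ) * Real.sin θ)) * r ^ n) 1).1
    hsum
  have hshift := hsum0.tsum_eq_zero_add
  simp only [Nat.cast_zero, zero_mul, Real.sin_zero, mul_zero, zero_add] at hshift
  rw [← hshift, ← hq'.of_abs.tsum_add hsum0]
  refine tsum_congr fun n => ?_
  have hY := (dihedralCoeffSum_pos (k := k) n hlam).ne'
  have hv := eval_dihedralCosPoly_vertex lam hk0 n p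
  have ha := eval_dihedralCosPoly_sub_vertex lam hk0 n p θ
  rw [← hφ] at hv ha
  rw [hq.wminus_kernel hlam hk0, hv, ha, ← mul_assoc, mul_div_cancel_right₀ _ hY]
  ring
end
end

section
/- Let λ > 0 and let k ≥ 1 be an integer. Set w(t) = |U_{k−1}(t)|^{2λ}(1−t²)^{λ−1/2} and w₂(t) = |U_{2k−1}(t)|^{2λ}(1−t²)^{λ−1/2} on (−1,1). Let (q_n)_{n≥0} be an orthogonal polynomial sequence for w and let (s_n)_{n≥0} be an orthogonal polynomial sequence for the weight (1+t)w(t). Define P_{2n}(t) = q_n(2t²−1) and P_{2n+1}(t) = t·s_n(2t²−1). Then (P_N)_{N≥0} is an orthogonal polynomial sequence for w₂, and the normalized squared norms satisfy (∫_{−1}^1 P_{2n}(t)² w₂(t)dt)/(∫_{−1}^1 w₂(t)dt) = (∫_{−1}^1 q_n(t)² w(t)dt)/(∫_{−1}^1 w(t)dt) and (∫_{−1}^1 P_{2n+1}(t)² w₂(t)dt)/(∫_{−1}^1 w₂(t)dt) = (1/2)·(∫_{−1}^1 s_n(t)² (1+t)w(t)dt)/(∫_{−1}^1 w(t)dt).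 (Note that ∫_{−1}^1 (1+t)w(t)dt = ∫_{−1}^1 w(t)dt since t·w(t) is odd.) -/
open Real MeasureTheory Polynomial Finset

noncomputable section

/-- `U_{2k-1}(X) = 2X · U_{k-1}(2X² - 1)`. -/
theorem chebyshev_U_two_mul_sub_one {k : ℕ} (hk : 1 ≤ k) :
    Chebyshev.U ℝ (2 * k - 1) = 2 * X * (Chebyshev.U ℝ (k - 1)).comp (2 * X ^ 2 - 1) := by
  have h := congrArg derivative (Chebyshev.T_mul ℝ (k : ℤ) 2)
  rw [derivative_comp, Chebyshev.T_derivative_eq_U, Chebyshev.T_derivative_eq_U,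
    Chebyshev.T_derivative_eq_U, Chebyshev.T_two, mul_comp, mul_comm (k : ℤ) 2] at h
  have hk' : ((k : ℤ) : ℝ[X]) ≠ 0 := by
    exact_mod_cast (by omega : k ≠ 0)
  apply mul_left_cancel₀ hk'
  apply mul_left_cancel₀ (two_ne_zero : (2 : ℝ[X]) ≠ 0)
  have h2 : Chebyshev.U ℝ (2 - 1) = 2 * X := by norm_num
  rw [h2] at h
  push_cast at h ⊢
  simp only [natCast_comp] at h
  linear_combination h

theorem wminus_two_mul {lam : ℝ} (hlam : 0 < lam) {k : ℕ} (hk : 1 ≤ k) {t : ℝ}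
    (ht : t ∈ Set.Icc (-1 : ℝ) 1) :
    wminus lam (2 * k) t = 2 * |t| * wminus lam k (2 * t ^ 2 - 1) := by
  have hU : chebU (((2 * k : ℕ) : ℤ) - 1) t
      = (2 * t) * chebU ((k : ℤ) - 1) (2 * t ^ 2 - 1) := by
    simp [chebU, chebyshev_U_two_mul_sub_one hk]
  have h1 : 0 ≤ 1 - t ^ 2 := by nlinarith [ht.1, ht.2]
  have h2 : 1 - (2 * t ^ 2 - 1) ^ 2 = |2 * t| ^ 2 * (1 - t ^ 2) := by
    rw [sq_abs]; ring
  rw [wminus, wminus, hU, h2, abs_mul, mul_rpow (abs_nonneg _) (abs_nonneg _),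
    mul_rpow (by positivity) h1]
  rcases eq_or_ne t 0 with rfl | h0
  · simp [zero_rpow (by positivity : 2 * lam ≠ 0)]
  · have hpos : 0 < |2 * t| := by positivity
    have h3 : |2 * t| ^ (2 * lam) = 2 * |t| * (|2 * t| ^ 2) ^ (lam - 1 / 2) := by
      rw [← rpow_natCast, ← rpow_mul hpos.le]
      conv_rhs => rw [show 2 * |t| = |2 * t| ^ (1 : ℝ) by simp [abs_mul]]
      rw [← rpow_add hpos]
      congr 1
      push_cast
      ring
    rw [h3]
    ring

theorem image_two_mul_sq_sub_one :
    (fun t : ℝ => 2 * t ^ 2 - 1) '' Set.Ioo 0 1 = Set.Ioo (-1) 1 := by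
  ext u
  constructor
  · rintro ⟨t, ⟨h0, h1⟩, rfl⟩
    constructor <;> nlinarith
  · rintro ⟨h0, h1⟩
    refine ⟨√((1 + u) / 2), ⟨by apply sqrt_pos.2; linarith, ?_⟩, ?_⟩
    · rw [sqrt_lt' one_pos]; linarith
    · simp only [sq_sqrt (by linarith : 0 ≤ (1 + u) / 2)]
      ring

/-- The substitution `u = 2t² - 1` folds `(-1, 1)` in two onto itself. -/
theorem integral_two_mul_abs_mul_comp (f : ℝ → ℝ) :
    ∫ t in (-1 : ℝ)..1, 2 * |t| * f (2 * t ^ 2 - 1) = ∫ u in (-1 : ℝ)..1, f u := by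
  have hderiv (t : ℝ) (_ : t ∈ Set.Ioo (0 : ℝ) 1) :
      HasDerivWithinAt (fun t : ℝ => 2 * t ^ 2 - 1) (4 * t) (Set.Ioo 0 1) t := by
    have := ((hasDerivAt_pow 2 t).const_mul 2).sub_const 1
    exact (this.congr_deriv (by simp; ring)).hasDerivWithinAt
  have hinj : Set.InjOn (fun t : ℝ => 2 * t ^ 2 - 1) (Set.Ioo 0 1) := by
    intro a ha b hb hab
    exact (sq_eq_sq₀ ha.1.le hb.1.le).1 (by linarith [show 2 * a ^ 2 - 1 = 2 * b ^ 2 - 1 from hab])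
  have hsubst := integral_image_eq_integral_abs_deriv_smul measurableSet_Ioo hderiv hinj f
  rw [image_two_mul_sq_sub_one] at hsubst
  have habs := integral_comp_abs
    (f := (Set.Iio (1 : ℝ)).indicator fun t => 2 * t * f (2 * t ^ 2 - 1))
  rw [setIntegral_indicator measurableSet_Iio, Set.Ioi_inter_Iio, ← integral_const_mul] at habs
  rw [intervalIntegral.integral_of_le (by norm_num), intervalIntegral.integral_of_le (by norm_num),
    integral_Ioc_eq_integral_Ioo, integral_Ioc_eq_integral_Ioo, hsubst]
  calc _ = ∫ t, (Set.Iio (1 : ℝ)).indicator (fun t => 2 * t * f (2 * t ^ 2 - 1)) |t| := by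
        rw [← integral_indicator measurableSet_Ioo]
        congr 1 with t
        simp [Set.indicator_apply, abs_lt]
    _ = _ := by
        rw [habs]
        refine setIntegral_congr_fun measurableSet_Ioo fun t ht => ?_
        simp only [smul_eq_mul, abs_of_pos (by linarith [ht.1] : 0 < 4 * t)]
        ring

theorem integral_comp_mul_wminus_two_mul {lam : ℝ} (hlam : 0 < lam) {k : ℕ} (hk : 1 ≤ k)
    (f : ℝ → ℝ) :
    ∫ t in (-1 : ℝ)..1, f (2 * t ^ 2 - 1) * wminus lam (2 * k) t
      = ∫ u in (-1 : ℝ)..1, f u * wminus lam k u := by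
  rw [← integral_two_mul_abs_mul_comp fun u => f u * wminus lam k u]
  refine intervalIntegral.integral_congr fun t ht => ?_
  rw [Set.uIcc_of_le (by norm_num)] at ht
  simp only [wminus_two_mul hlam hk ht]
  ring

theorem integral_wminus_two_mul {lam : ℝ} (hlam : 0 < lam) {k : ℕ} (hk : 1 ≤ k) :
    ∫ t in (-1 : ℝ)..1, wminus lam (2 * k) t = ∫ u in (-1 : ℝ)..1, wminus lam k u := by
  simpa using integral_comp_mul_wminus_two_mul hlam hk fun _ => 1

theorem integral_sq_mul_comp_mul_wminus_two_mul {lam : ℝ} (hlam : 0 < lam) {k : ℕ} (hk : 1 ≤ k)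
    (f : ℝ → ℝ) :
    ∫ t in (-1 : ℝ)..1, t ^ 2 * f (2 * t ^ 2 - 1) * wminus lam (2 * k) t
      = 1 / 2 * ∫ u in (-1 : ℝ)..1, f u * ((1 + u) * wminus lam k u) := by
  have h := integral_comp_mul_wminus_two_mul hlam hk fun u => (1 + u) / 2 * f u
  rw [← intervalIntegral.integral_const_mul]
  calc _ = _ := by
        congr 1 with t
        ring
    _ = _ := h
    _ = _ := by
        congr 1 with u
        ring

theorem integral_mul_comp_mul_wminus_two_mul {lam : ℝ} (hlam : 0 < lam) {k : ℕ} (hk : 1 ≤ k)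
    (f : ℝ → ℝ) :
    ∫ t in (-1 : ℝ)..1, t * f (2 * t ^ 2 - 1) * wminus lam (2 * k) t = 0 := by
  have h : ∫ t in (-1 : ℝ)..1, t * f (2 * t ^ 2 - 1) * wminus lam (2 * k) t
      = -∫ t in (-1 : ℝ)..1, t * f (2 * t ^ 2 - 1) * wminus lam (2 * k) t := by
    conv_lhs => rw [← neg_neg (1 : ℝ), ← intervalIntegral.integral_comp_neg, neg_neg]
    rw [← intervalIntegral.integral_neg]
    refine intervalIntegral.integral_congr fun t ht => ?_
    rw [Set.uIcc_of_le (by norm_num)] at ht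
    have ht' : -t ∈ Set.Icc (-1 : ℝ) 1 := ⟨by linarith [ht.2], by linarith [ht.1]⟩
    simp only [wminus_two_mul hlam hk ht, wminus_two_mul hlam hk ht', abs_neg, neg_sq]
    ring
  linarith

theorem degree_comp_two_mul_sq_sub_one {p : ℝ[X]} {n : ℕ} (hp : p.degree = n) :
    (p.comp (2 * X ^ 2 - 1)).degree = (2 * n : ℕ) := by
  have hX : (2 * X ^ 2 - 1 : ℝ[X]).natDegree = 2 := by
    rw [← Chebyshev.T_two, Chebyshev.natDegree_T]; rfl
  have hp' := natDegree_eq_of_degree_eq_some hp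
  have h0 : p ≠ 0 := by rintro rfl; simp at hp
  have hc : p.comp (2 * X ^ 2 - 1) ≠ 0 := by
    intro h
    rcases comp_eq_zero_iff.1 h with h | ⟨_, h⟩
    · exact h0 h
    · rw [h, natDegree_C] at hX
      omega
  rw [degree_eq_natDegree hc, natDegree_comp, hX, hp', mul_comm]

/-- the quadratic transformation relating the orthogonal polynomials for the
dihedral weight of order `2k` to those of order `k`:
`P_{2n}(t) = q_n(2t²−1)`, `P_{2n+1}(t) = t·s_n(2t²−1)`. -/
theorem quadratic_transformation (lam : ℝ) (hlam : 0 < lam) (k : ℕ) (hk : 1 ≤ k)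
    (q s : ℕ → Polynomial ℝ) (hq : IsOPS (wminus lam k) q)
    (hs : IsOPS (fun t => (1 + t) * wminus lam k t) s) :
    IsOPS (wminus lam (2 * k))
      (fun N => if 2 ∣ N then (q (N / 2)).comp (2 * X ^ 2 - 1)
        else X * (s (N / 2)).comp (2 * X ^ 2 - 1)) ∧
    (∀ n : ℕ, hnorm (wminus lam (2 * k)) ((q n).comp (2 * X ^ 2 - 1)) =
      hnorm (wminus lam k) (q n)) ∧
    (∀ n : ℕ, hnorm (wminus lam (2 * k)) (X * (s n).comp (2 * X ^ 2 - 1)) =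
      (1 / 2) * ((∫ t in (-1 : ℝ)..1, ((s n).eval t) ^ 2 * ((1 + t) * wminus lam k t)) /
        (∫ t in (-1 : ℝ)..1, wminus lam k t))) := by
  refine ⟨⟨fun N => ?_, fun N M hNM => ?_⟩, fun n => ?_, fun n => ?_⟩
  · rcases Nat.even_or_odd' N with ⟨n, rfl | rfl⟩
    · simpa using degree_comp_two_mul_sq_sub_one (hq.1 n)
    · have hodd : ¬ 2 ∣ 2 * n + 1 := by omega
      have hdiv : (2 * n + 1) / 2 = n := by omega
      simp only [hodd, if_false, hdiv]
      rw [degree_mul, degree_X, degree_comp_two_mul_sq_sub_one (hs.1 n)]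
      norm_cast
      omega
  · have heven (n : ℕ) : 2 ∣ 2 * n := ⟨n, rfl⟩
    have hodd (n : ℕ) : ¬ 2 ∣ 2 * n + 1 := by omega
    have hdiv (n : ℕ) : 2 * n / 2 = n := by omega
    have hdiv' (n : ℕ) : (2 * n + 1) / 2 = n := by omega
    rcases Nat.even_or_odd' N with ⟨n, rfl | rfl⟩ <;>
      rcases Nat.even_or_odd' M with ⟨m, rfl | rfl⟩ <;>
      simp only [heven, hodd, if_true, if_false, hdiv, hdiv', eval_mul, eval_comp, eval_X,
        eval_sub, eval_pow, eval_one, eval_ofNat]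
    · rw [integral_comp_mul_wminus_two_mul hlam hk fun u => (q n).eval u * (q m).eval u]
      exact hq.2 n m (by omega)
    · rw [← integral_mul_comp_mul_wminus_two_mul hlam hk fun u => (q n).eval u * (s m).eval u]
      congr 1 with t
      ring
    · rw [← integral_mul_comp_mul_wminus_two_mul hlam hk fun u => (s n).eval u * (q m).eval u]
      congr 1 with t
      ring
    · have h := integral_sq_mul_comp_mul_wminus_two_mul hlam hk
        fun u => (s n).eval u * (s m).eval u
      rw [hs.2 n m (by omega), mul_zero] at h
      rw [← h]
      congr 1 with t
      ring
  · have h := integral_comp_mul_wminus_two_mul hlam hk fun u => (q n).eval u ^ 2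
    simp [hnorm, integral_wminus_two_mul hlam hk, ← h]
  · rw [← mul_div_assoc,
      ← integral_sq_mul_comp_mul_wminus_two_mul hlam hk fun u => (s n).eval u ^ 2]
    simp [hnorm, integral_wminus_two_mul hlam hk, mul_pow]
end
end
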